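/- arXiv:2004.09310 — 2 statements merged into one kernel-verified Lean document; each statement's English description precedes it below -/
import Mathlib

section
/- Let d ≥ 4 and n ≥ 3. For generic f ∈ S^d, for every nonzero linear form x ∈ S^1, the multiplication map by x from R_f^{d-1} to R_f^d is injective. (Equivalently, a generic degree-d form f satisfies no equation of the type ∂_u(f) vanishes identically on a hyperplane H ⊂ P^n, for any nonzero constant vector field u and hyperplane H.) -/
open MvPolynomial

noncomputable section

abbrev S (n : ℕ) : Type := MvPolynomial (Fin (n + 1)) ℂ

/-- The Jacobian ideal of `f`, generated by its partial derivatives. -/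
def jacobianIdeal {n : ℕ} (f : S n) : Ideal (S n) :=
  Ideal.span (Set.range fun i => MvPolynomial.pderiv i f)

/-- The degree-`k` graded piece of `S/I`: the image of the homogeneous degree-`k`
polynomials in the quotient. -/
def quotPiece {n : ℕ} (I : Ideal (S n)) (k : ℕ) : Submodule ℂ (S n ⧸ I) :=
  (MvPolynomial.homogeneousSubmodule (Fin (n + 1)) ℂ k).map
    (Ideal.Quotient.mkₐ ℂ I).toLinearMap

/-- The degree-`k` graded piece `R_f^k` of the Jacobian ring `R_f = S/J_f`. -/
def Rpiece {n : ℕ} (f : S n) (k : ℕ) : Submodule ℂ (S n ⧸ jacobianIdeal f) :=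
  quotPiece (jacobianIdeal f) k

/-- `f` defines a smooth hypersurface: its partial derivatives have no common
zero in `ℂ^{n+1} \ {0}`. -/
def SmoothHyp {n : ℕ} (f : S n) : Prop :=
  ∀ v : Fin (n + 1) → ℂ, (∀ i, MvPolynomial.eval v (MvPolynomial.pderiv i f) = 0) → v = 0

/-- A polynomial function on a complex vector space: an element of the algebra of
functions generated by the linear functionals. -/
def IsPolyFun {M : Type} [AddCommGroup M] [Module ℂ M] (φ : M → ℂ) : Prop :=
  φ ∈ Algebra.adjoin ℂ {ψ : M → ℂ | ∃ l : M →ₗ[ℂ] ℂ, ψ = ⇑l}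

/-- A property `P` holds for generic points of `M`: it holds on a nonempty
Zariski-open subset, i.e. on the nonvanishing locus of some polynomial function
that is not identically zero. -/
def GenericallyHolds {M : Type} [AddCommGroup M] [Module ℂ M] (P : M → Prop) : Prop :=
  ∃ φ : M → ℂ, IsPolyFun φ ∧ (∃ x, φ x ≠ 0) ∧ ∀ x, φ x ≠ 0 → P x

/-- Substitution of the linear change of coordinates given by the matrix `A`. -/
def substLin {n : ℕ} (A : Matrix (Fin (n + 1)) (Fin (n + 1)) ℂ) (f : S n) : S n :=
  MvPolynomial.aeval (fun i => ∑ j, A i j • MvPolynomial.X j) f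

/-- A regular sequence: each `f i` is a nonzerodivisor modulo the previous ones. -/
def IsRegularSeq {n c : ℕ} (f : Fin c → S n) : Prop :=
  ∀ (i : Fin c) (g : S n),
    f i * g ∈ Ideal.span (f '' {j | j < i}) → g ∈ Ideal.span (f '' {j | j < i})

/-- Zariski-closed subset of a complex vector space: common zero locus of a set of
polynomial functions. -/
def IsZariskiClosed {M : Type} [AddCommGroup M] [Module ℂ M] (T : Set M) : Prop :=
  ∃ 𝒮 : Set (M → ℂ), (∀ φ ∈ 𝒮, IsPolyFun φ) ∧ T = {x | ∀ φ ∈ 𝒮, φ x = 0}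

/-- An irreducible Zariski-closed subset. -/
def IsIrredClosed {M : Type} [AddCommGroup M] [Module ℂ M] (Z : Set M) : Prop :=
  IsZariskiClosed Z ∧ Z.Nonempty ∧
    ∀ C₁ C₂ : Set M, IsZariskiClosed C₁ → IsZariskiClosed C₂ →
      Z ⊆ C₁ ∪ C₂ → Z ⊆ C₁ ∨ Z ⊆ C₂

/-- The (Krull) dimension of the algebraic set `T` is at least `m`: there is a strictly
increasing chain of `m+1` irreducible closed subsets contained in `T`. -/
def algDimGE {M : Type} [AddCommGroup M] [Module ℂ M] (T : Set M) (m : ℕ) : Prop :=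
  ∃ Z : Fin (m + 1) → Set M, StrictMono Z ∧ (∀ i, IsIrredClosed (Z i)) ∧
    Z (Fin.last m) ⊆ T

/-- Spreading out: an algebraic condition implied by the system `I` at all points whose
`σ`-coordinates are algebraically independent over `ℂ` is implied by `I` at all complex points
whose `σ`-coordinates avoid a hypersurface. -/
theorem exists_ne_zero_forall_eval_eq_zero {σ τ : Type} (I : Set (MvPolynomial (σ ⊕ τ) ℂ))
    (g : MvPolynomial (σ ⊕ τ) ℂ)
    (h : ∀ (K : Type) [Field K] [Algebra ℂ K] (z : σ ⊕ τ → K),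
      AlgebraicIndependent ℂ (fun i => z (Sum.inl i)) → (∀ p ∈ I, aeval z p = 0) →
        aeval z g = 0) :
    ∃ φ : MvPolynomial σ ℂ, φ ≠ 0 ∧ ∀ z : σ ⊕ τ → ℂ, eval (fun i => z (Sum.inl i)) φ ≠ 0 →
      (∀ p ∈ I, eval z p = 0) → eval z g = 0 := by
  classical
  let ρ : MvPolynomial σ ℂ →ₐ[ℂ] MvPolynomial (σ ⊕ τ) ℂ := rename Sum.inl
  have key : ∃ φ : MvPolynomial σ ℂ, φ ≠ 0 ∧ ∃ N : ℕ, ρ φ * g ^ N ∈ Ideal.span I := by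
    by_contra hcon
    push Not at hcon
    let M : Submonoid (MvPolynomial (σ ⊕ τ) ℂ) :=
      (nonZeroDivisors (MvPolynomial σ ℂ)).map ρ ⊔ Submonoid.powers g
    have hdisj : Disjoint (Ideal.span I : Set (MvPolynomial (σ ⊕ τ) ℂ)) (M : Set _) := by
      rw [Set.disjoint_left]
      rintro y hy hyM
      obtain ⟨a, ⟨φ, hφ, rfl⟩, b, ⟨N, rfl⟩, rfl⟩ := Submonoid.mem_sup.1 hyM
      exact hcon φ (nonZeroDivisors.ne_zero hφ) N hy
    obtain ⟨P, hP, hIP, hPM⟩ := Ideal.exists_le_prime_disjoint (Ideal.span I) M hdisj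
    let K := FractionRing (MvPolynomial (σ ⊕ τ) ℂ ⧸ P)
    let ψ : MvPolynomial (σ ⊕ τ) ℂ →ₐ[ℂ] K :=
      (IsScalarTower.toAlgHom ℂ (MvPolynomial (σ ⊕ τ) ℂ ⧸ P) K).comp (Ideal.Quotient.mkₐ ℂ P)
    have hψ : ∀ q, ψ q = 0 ↔ q ∈ P := by
      intro q
      change algebraMap (MvPolynomial (σ ⊕ τ) ℂ ⧸ P) K (Ideal.Quotient.mk P q) = 0 ↔ _
      rw [FaithfulSMul.algebraMap_eq_zero_iff, Ideal.Quotient.eq_zero_iff_mem]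
    have hae : ∀ q, aeval (fun i => ψ (X i)) q = ψ q := fun q => by
      have : aeval (fun i => ψ (X i)) = ψ := by ext; simp
      rw [this]
    have h1 := h K (fun i => ψ (X i)) ?_ ?_
    · rw [hae, hψ] at h1
      exact Set.disjoint_left.1 hPM h1
        (Submonoid.mem_sup_right (Submonoid.mem_powers g))
    · rw [algebraicIndependent_iff]
      intro q hq
      by_contra hq0
      have : ψ (ρ q) = 0 := by
        rw [← hae, aeval_rename]; exact hq
      exact Set.disjoint_left.1 hPM ((hψ _).1 this)
        (Submonoid.mem_sup_left ⟨q, mem_nonZeroDivisors_of_ne_zero hq0, rfl⟩)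
    · intro p hp
      rw [hae, hψ]
      exact hIP (Ideal.subset_span hp)
  obtain ⟨φ, hφ, N, hN⟩ := key
  refine ⟨φ, hφ, fun z hz hI => ?_⟩
  have h2 : Ideal.span I ≤ RingHom.ker (eval z) := Ideal.span_le.2 fun p hp => hI p hp
  have h3 := h2 hN
  rw [RingHom.mem_ker, map_mul, map_pow] at h3
  have h4 : eval z (ρ φ) = eval (fun i => z (Sum.inl i)) φ := by
    simp [ρ, eval_rename]; rfl
  rw [h4] at h3
  exact eq_zero_of_pow_eq_zero ((mul_eq_zero.1 h3).resolve_left hz)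

/-- Exponents of the monomials of degree `d` in `n` variables. -/
abbrev Mon (n d : ℕ) : Type := ↥(Finset.finsuppAntidiag (Finset.univ : Finset (Fin n)) d)

/-- The form of degree `d` with given coefficients. -/
def formOf {R : Type*} [CommSemiring R] {n d : ℕ} (c : Mon n d → R) : MvPolynomial (Fin n) R :=
  ∑ m, monomial m.1 (c m)

/-- The linear form with given coefficients. -/
def lin {R : Type*} [CommSemiring R] {n : ℕ} (h : Fin n → R) : MvPolynomial (Fin n) R :=
  ∑ j, C (h j) * X j

theorem mem_finsuppAntidiag_univ_iff {n d : ℕ} {m : Fin n →₀ ℕ} :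
    m ∈ Finset.finsuppAntidiag (Finset.univ : Finset (Fin n)) d ↔ m.degree = d := by
  simp [Finset.mem_finsuppAntidiag, Finsupp.degree_eq_sum]

theorem isHomogeneous_formOf {R : Type*} [CommSemiring R] {n d : ℕ} (c : Mon n d → R) :
    (formOf c).IsHomogeneous d :=
  IsHomogeneous.sum _ _ _ fun m _ =>
    isHomogeneous_monomial _ (mem_finsuppAntidiag_univ_iff.1 m.2)

theorem coeff_formOf {R : Type*} [CommSemiring R] {n d : ℕ} (c : Mon n d → R) (m : Mon n d) :
    coeff m.1 (formOf c) = c m := by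
  classical
  simp [formOf, coeff_sum, coeff_monomial, Finset.sum_ite_eq']

theorem formOf_coeff {R : Type*} [CommSemiring R] {n d : ℕ} {f : MvPolynomial (Fin n) R}
    (hf : f.IsHomogeneous d) : formOf (fun m : Mon n d => coeff m.1 f) = f := by
  classical
  ext m
  by_cases hm : m.degree = d
  · exact coeff_formOf _ ⟨m, mem_finsuppAntidiag_univ_iff.2 hm⟩
  · rw [(isHomogeneous_formOf _).coeff_eq_zero hm, hf.coeff_eq_zero hm]

theorem map_formOf {R R' : Type*} [CommSemiring R] [CommSemiring R'] (ψ : R →+* R') {n d : ℕ}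
    (c : Mon n d → R) : map ψ (formOf c) = formOf (fun m => ψ (c m)) := by
  simp [formOf]

theorem map_lin {R R' : Type*} [CommSemiring R] [CommSemiring R'] (ψ : R →+* R') {n : ℕ}
    (h : Fin n → R) : map ψ (lin h) = lin (fun j => ψ (h j)) := by
  simp [lin]

theorem isHomogeneous_lin {R : Type*} [CommSemiring R] {n : ℕ} (h : Fin n → R) :
    (lin h).IsHomogeneous 1 :=
  IsHomogeneous.sum _ _ _ fun j _ => by
    simpa using (isHomogeneous_C _ (h j)).mul (isHomogeneous_X R j)

theorem coeff_lin {R : Type*} [CommSemiring R] {n : ℕ} (h : Fin n → R) (j : Fin n) :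
    coeff (Finsupp.single j 1) (lin h) = h j := by
  classical
  simp [lin, coeff_sum, coeff_C_mul, coeff_X, Finsupp.single_left_inj]

theorem lin_coeff {R : Type*} [CommSemiring R] {n : ℕ} {x : MvPolynomial (Fin n) R}
    (hx : x.IsHomogeneous 1) : lin (fun j => coeff (Finsupp.single j 1) x) = x := by
  classical
  ext m
  by_cases hm : m.degree = 1
  · obtain ⟨j, rfl⟩ : ∃ j, m = Finsupp.single j 1 := by
      exact (Finsupp.sum_eq_one_iff m).1 hm
    exact coeff_lin _ j
  · rw [(isHomogeneous_lin _).coeff_eq_zero hm, hx.coeff_eq_zero hm]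

/-- The derivative in the direction of a constant vector. -/
def dirDeriv {R : Type*} [CommRing R] {n : ℕ} (x : Fin n → R) :
    Derivation R (MvPolynomial (Fin n) R) (MvPolynomial (Fin n) R) :=
  ∑ j, (C (x j) : MvPolynomial (Fin n) R) • pderiv j

/-- The derivation acting on linear forms by a matrix. -/
def linDeriv {R : Type*} [CommRing R] {n : ℕ} (l : Matrix (Fin n) (Fin n) R) :
    Derivation R (MvPolynomial (Fin n) R) (MvPolynomial (Fin n) R) :=
  ∑ j, lin (fun i => l i j) • pderiv j

theorem derivation_sum_apply {R A ι : Type*} [CommRing R] [CommRing A] [Algebra R A]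
    (s : Finset ι) (δ : ι → Derivation R A A) (a : A) : (∑ i ∈ s, δ i) a = ∑ i ∈ s, δ i a := by
  classical
  induction s using Finset.induction_on with
  | empty => simp
  | insert i s hi ih => rw [Finset.sum_insert hi, Finset.sum_insert hi, Derivation.add_apply, ih]

theorem dirDeriv_apply {R : Type*} [CommRing R] {n : ℕ} (x : Fin n → R)
    (P : MvPolynomial (Fin n) R) : dirDeriv x P = ∑ j, C (x j) * pderiv j P := by
  simp [dirDeriv, derivation_sum_apply]

theorem linDeriv_apply {R : Type*} [CommRing R] {n : ℕ} (l : Matrix (Fin n) (Fin n) R)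
    (P : MvPolynomial (Fin n) R) :
    linDeriv l P = ∑ j, lin (fun i => l i j) * pderiv j P := by
  simp [linDeriv, derivation_sum_apply]

/-- The apolarity pairing of polynomials. -/
def pair {R : Type*} [CommRing R] {n : ℕ} :
    MvPolynomial (Fin n) R →ₗ[R] MvPolynomial (Fin n) R →ₗ[R] R :=
  (basisMonomials (Fin n) R).constr R fun m => (((∏ i, (m i).factorial : ℕ)) : R) • lcoeff R m

theorem pair_monomial {R : Type*} [CommRing R] {n : ℕ} (m : Fin n →₀ ℕ) (a : R)
    (Q : MvPolynomial (Fin n) R) :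
    pair (monomial m a) Q = a * ((∏ i, (m i).factorial : ℕ)) * coeff m Q := by
  have h1 : monomial m a = a • basisMonomials (Fin n) R m := by
    rw [coe_basisMonomials, smul_monomial, smul_eq_mul, mul_one]
  rw [h1, map_smul, pair, Module.Basis.constr_basis]
  simp [lcoeff_apply, mul_assoc]

theorem prod_factorial_add_single {n : ℕ} (m : Fin n →₀ ℕ) (j : Fin n) :
    ∏ i, ((m + Finsupp.single j 1 : Fin n →₀ ℕ) i).factorial =
      (m j + 1) * ∏ i, (m i).factorial := by
  classical
  rw [← Finset.mul_prod_erase _ _ (Finset.mem_univ j),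
    ← Finset.mul_prod_erase _ (fun i => (m i).factorial) (Finset.mem_univ j), ← mul_assoc]
  congr 1
  · simp [Nat.factorial_succ]
  · refine Finset.prod_congr rfl fun i hi => ?_
    simp [Finsupp.single_eq_of_ne (Finset.ne_of_mem_erase hi)]

theorem pair_X_mul_right {R : Type*} [CommRing R] {n : ℕ} (j : Fin n)
    (P Q : MvPolynomial (Fin n) R) : pair P (X j * Q) = pair (pderiv j P) Q := by
  classical
  induction P using MvPolynomial.induction_on' with
  | add p q hp hq => simp only [map_add, LinearMap.add_apply, hp, hq]
  | monomial m a =>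
    rw [pderiv_monomial, pair_monomial, pair_monomial, coeff_X_mul']
    by_cases hj : m j = 0
    · simp [hj]
    · obtain ⟨m, rfl⟩ : ∃ m', m = m' + Finsupp.single j 1 :=
        ⟨m - Finsupp.single j 1, (tsub_add_cancel_of_le (by
          rw [Finsupp.single_le_iff]; omega)).symm⟩
      rw [if_pos (by simp), prod_factorial_add_single]
      simp only [add_tsub_cancel_right]
      simp
      ring

theorem pair_pderiv_right {R : Type*} [CommRing R] {n : ℕ} (j : Fin n)
    (P Q : MvPolynomial (Fin n) R) : pair P (pderiv j Q) = pair (X j * P) Q := by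
  classical
  induction P using MvPolynomial.induction_on' with
  | add p q hp hq => simp only [map_add, LinearMap.add_apply, hp, hq, mul_add]
  | monomial m a =>
    rw [mul_comm, ← pow_one (X j), ← monomial_add_single, pair_monomial, pair_monomial,
      prod_factorial_add_single, coeff_pderiv]
    push_cast
    ring

theorem pair_linDeriv_eq_zero {R : Type*} [CommRing R] {n : ℕ} {x : Fin n → R}
    {l : Matrix (Fin n) (Fin n) R} {f p P : MvPolynomial (Fin n) R}
    (h : lin x * p = ∑ i, lin (l i) * pderiv i f) (hP : dirDeriv x P = 0) :
    pair (linDeriv l P) f = 0 := by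
  have hC : ∀ (a : R) (A B : MvPolynomial (Fin n) R), pair (C a * A) B = a * pair A B := by
    intro a A B; rw [← smul_eq_C_mul, map_smul, LinearMap.smul_apply, smul_eq_mul]
  have hC' : ∀ (a : R) (A B : MvPolynomial (Fin n) R), pair A (C a * B) = a * pair A B := by
    intro a A B; rw [← smul_eq_C_mul, map_smul, smul_eq_mul]
  have h1 : pair P (lin x * p) = 0 := by
    have : pair P (lin x * p) = pair (dirDeriv x P) p := by
      simp only [dirDeriv_apply, lin, Finset.sum_mul, map_sum, mul_assoc, hC, hC',
        pair_X_mul_right, LinearMap.sum_apply]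
    rw [this, hP, map_zero, LinearMap.zero_apply]
  rw [h] at h1
  rw [← h1]
  simp only [linDeriv_apply, lin, Finset.sum_mul, map_sum, mul_assoc, hC, hC',
        pair_X_mul_right, LinearMap.sum_apply, pair_pderiv_right]
  exact Finset.sum_comm

theorem pderiv_lin {R : Type*} [CommRing R] {n : ℕ} (h : Fin n → R) (j : Fin n) :
    pderiv j (lin h) = C (h j) := by
  classical
  simp [lin, pderiv_X, Pi.single_apply]

open scoped Matrix in
theorem dirDeriv_lin {R : Type*} [CommRing R] {n : ℕ} (x h : Fin n → R) :
    dirDeriv x (lin h) = C (x ⬝ᵥ h) := by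
  simp [dirDeriv_apply, pderiv_lin, dotProduct]

open scoped Matrix in
theorem linDeriv_lin {R : Type*} [CommRing R] {n : ℕ} (l : Matrix (Fin n) (Fin n) R)
    (h : Fin n → R) : linDeriv l (lin h) = lin (l *ᵥ h) := by
  simp only [linDeriv_apply, pderiv_lin]
  simp only [lin, Matrix.mulVec, dotProduct, Finset.sum_mul, map_sum]
  rw [Finset.sum_comm]
  refine Finset.sum_congr rfl fun i _ => Finset.sum_congr rfl fun j _ => ?_
  rw [C_mul]; ring

theorem isHomogeneous_linDeriv {R : Type*} [CommRing R] {n d : ℕ} (l : Matrix (Fin n) (Fin n) R)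
    {P : MvPolynomial (Fin n) R} (hd : d ≠ 0) (hP : P.IsHomogeneous d) :
    (linDeriv l P).IsHomogeneous d := by
  rw [linDeriv_apply]
  refine IsHomogeneous.sum _ _ _ fun j _ => ?_
  have h := (isHomogeneous_lin fun i => l i j).mul (hP.pderiv (i := j))
  rwa [show 1 + (d - 1) = d by omega] at h

/-- There is a space of forms of degree `d`, of dimension at least `r`, killed by the derivative
along `x` on which the derivation given by `l` is injective. -/
def HasRank {E : Type*} [Field E] {n : ℕ} (x : Fin n → E) (l : Matrix (Fin n) (Fin n) E)
    (d r : ℕ) : Prop :=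
  ∃ V : Submodule E (MvPolynomial (Fin n) E), V ≤ homogeneousSubmodule (Fin n) E d ∧
    (∀ P ∈ V, dirDeriv x P = 0) ∧ (∀ P ∈ V, linDeriv l P = 0 → P = 0) ∧ r ≤ Module.finrank E V

theorem HasRank.of_linearMap {E : Type*} [Field E] {n d r : ℕ} {x : Fin n → E}
    {l : Matrix (Fin n) (Fin n) E} {M : Type*} [AddCommGroup M] [Module E M]
    (β : M →ₗ[E] MvPolynomial (Fin n) E) (h1 : ∀ m, (β m).IsHomogeneous d)
    (h2 : ∀ m, dirDeriv x (β m) = 0) (h3 : ∀ m, linDeriv l (β m) = 0 → m = 0)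
    (hr : r ≤ Module.finrank E M) : HasRank x l d r := by
  have hβ : Function.Injective β := by
    rw [injective_iff_map_eq_zero]
    intro m hm
    exact h3 m (by rw [hm, map_zero])
  refine ⟨LinearMap.range β, ?_, ?_, ?_, by rwa [LinearMap.finrank_range_of_inj hβ]⟩
  · rintro _ ⟨m, rfl⟩
    exact h1 m
  · rintro _ ⟨m, rfl⟩
    exact h2 m
  · rintro _ ⟨m, rfl⟩ h
    rw [h3 m h, map_zero]

theorem card_le_trdeg_add {E K : Type} [Field E] [Field K] [Algebra ℂ E] [Algebra E K]
    [Algebra ℂ K] [IsScalarTower ℂ E K] {ι : Type} [Fintype ι] {c : ι → K}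
    (hc : AlgebraicIndependent ℂ c) {s : ℕ} (b : Fin s → K)
    (hb : ∀ i, c i ∈ (aeval b : MvPolynomial (Fin s) E →ₐ[E] K).range) :
    (Fintype.card ι : Cardinal) ≤ Algebra.trdeg ℂ E + s := by
  let A := (aeval b : MvPolynomial (Fin s) E →ₐ[E] K).range
  have h1 : Algebra.trdeg E A ≤ s := by
    have := trdeg_le_of_surjective (aeval b : MvPolynomial (Fin s) E →ₐ[E] K).rangeRestrict
      (AlgHom.rangeRestrict_surjective _)
    simpa using this
  have h2 : AlgebraicIndependent ℂ (fun i => (⟨c i, hb i⟩ : A)) := by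
    exact AlgebraicIndependent.of_comp (A.val.restrictScalars ℂ) hc
  have h3 := h2.cardinalMk_le_trdeg
  rw [← trdeg_add_eq ℂ E (A := A)] at h3
  rw [Cardinal.mk_fintype] at h3
  exact h3.trans (add_le_add le_rfl h1)

theorem HasRank.le_trdeg {n d r : ℕ} {E K : Type} [Field E] [Field K] [Algebra ℂ E] [Algebra E K]
    [Algebra ℂ K] [IsScalarTower ℂ E K] (hd : d ≠ 0) {c : Mon n d → K}
    (hc : AlgebraicIndependent ℂ c) {x : Fin n → E} {l : Matrix (Fin n) (Fin n) E}
    {x' : Fin n → K} {l' : Matrix (Fin n) (Fin n) K} (hx' : ∀ j, algebraMap E K (x j) = x' j)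
    (hl' : ∀ i j, algebraMap E K (l i j) = l' i j) {p : MvPolynomial (Fin n) K}
    (h : lin x' * p = ∑ i, lin (l' i) * pderiv i (formOf c))
    (hr : HasRank x l d r) : (r : Cardinal) ≤ Algebra.trdeg ℂ E := by
  classical
  obtain rfl : x' = fun j => algebraMap E K (x j) := _root_.funext fun j => (hx' j).symm
  obtain rfl : l' = l.map (algebraMap E K) := by
    ext i j
    exact (hl' i j).symm
  obtain ⟨V, hVd, hVx, hVl, hVr⟩ := hr
  have hchar : CharZero K := charZero_of_injective_algebraMap (algebraMap ℂ K).injective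
  let fac : Mon n d → K := fun m => ((∏ i, (m.1 i).factorial : ℕ) : K)
  have hfac : ∀ m, fac m ≠ 0 := fun m => by
    simp only [fac, Nat.cast_ne_zero]
    exact Finset.prod_ne_zero_iff.2 fun i _ => Nat.factorial_ne_zero _
  let T : (Mon n d → E) →ₗ[E] K := Fintype.linearCombination E (fun m => fac m * c m)
  let κ : MvPolynomial (Fin n) E →ₗ[E] (Mon n d → E) := LinearMap.pi fun m => lcoeff E m.1
  let γ : V →ₗ[E] (Mon n d → E) := κ.comp ((linDeriv l).toLinearMap.comp V.subtype)
  have hγ : Function.Injective γ := by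
    rw [injective_iff_map_eq_zero]
    rintro ⟨P, hP⟩ h0
    have h1 : linDeriv l P = 0 := by
      rw [← formOf_coeff (isHomogeneous_linDeriv l hd (hVd hP))]
      have : (fun m : Mon n d => coeff m.1 (linDeriv l P)) = 0 := h0
      rw [this]
      simp [formOf]
    exact Subtype.ext (hVl P hP h1)
  have hT : LinearMap.range γ ≤ LinearMap.ker T := by
    rintro _ ⟨⟨P, hP⟩, rfl⟩
    rw [LinearMap.mem_ker]
    have hx : dirDeriv (fun j => algebraMap E K (x j)) (map (algebraMap E K) P) = 0 := by
      have := congrArg (map (algebraMap E K)) (hVx P hP)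
      simpa [dirDeriv_apply, pderiv_map] using this
    have h1 := pair_linDeriv_eq_zero (l := l.map (algebraMap E K)) h hx
    have h2 : linDeriv (l.map (algebraMap E K)) (map (algebraMap E K) P) =
        formOf fun m => algebraMap E K (γ ⟨P, hP⟩ m) := by
      rw [← map_formOf]
      have : formOf (γ ⟨P, hP⟩) = linDeriv l P :=
        formOf_coeff (isHomogeneous_linDeriv l hd (hVd hP))
      rw [this]
      simp [linDeriv_apply, pderiv_map, map_lin]
    have h3 : ∀ e : Mon n d → K, pair (formOf e) (formOf c) = ∑ m, e m * (fac m * c m) := by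
      intro e
      have : formOf e = ∑ m, monomial m.1 (e m) := rfl
      rw [this]
      simp only [map_sum, LinearMap.sum_apply, pair_monomial, coeff_formOf, fac, mul_assoc]
    rw [h2, h3] at h1
    rw [Fintype.linearCombination_apply, ← h1]
    simp only [Algebra.smul_def]
  have h1 : r ≤ Module.finrank E (LinearMap.ker T) :=
    hVr.trans ((LinearMap.finrank_range_of_inj hγ).symm.le.trans (Submodule.finrank_mono hT))
  have h2 := LinearMap.finrank_range_add_finrank_ker T
  rw [Module.finrank_fintype_fun_eq_card] at h2
  let b := Module.finBasis E (LinearMap.range T)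
  have h3 := card_le_trdeg_add (E := E) hc (fun i => (b i : K)) (by
    intro m
    have h4 : fac m * c m ∈ LinearMap.range T :=
      ⟨Pi.single m 1, by simp [T, Fintype.linearCombination_apply_single]⟩
    have h5 : ((⟨_, h4⟩ : LinearMap.range T) : K) = _ :=
      congrArg Subtype.val (b.sum_repr ⟨_, h4⟩).symm
    have h6 : fac m * c m ∈ (aeval fun i => (b i : K) : MvPolynomial (Fin _) E →ₐ[E] K).range := by
      rw [show fac m * c m = _ from h5, Submodule.coe_sum]
      refine Subalgebra.sum_mem _ fun i _ => ?_
      exact Subalgebra.smul_mem _ ((AlgHom.mem_range _).2 ⟨X i, by simp⟩) _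
    have h7 := Subalgebra.smul_mem _ h6 (((∏ i, (m.1 i).factorial : ℕ) : E)⁻¹)
    rwa [Algebra.smul_def, map_inv₀, map_natCast, inv_mul_cancel_left₀ (hfac m)] at h7)
  by_cases ht : Algebra.trdeg ℂ E < Cardinal.aleph0
  · obtain ⟨t, ht⟩ := Cardinal.lt_aleph0.1 ht
    rw [ht] at h3 ⊢
    norm_cast at h3 ⊢
    omega
  · exact (Cardinal.natCast_lt_aleph0).le.trans (not_lt.1 ht)

theorem isAlgebraic_adjoin_range {E : Type} [Field E] [Algebra ℂ E] {s : Set E}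
    (hs : IntermediateField.adjoin ℂ s = ⊤) {τ : Type} {g : τ → E}
    (h : s ⊆ Algebra.adjoin ℂ (Set.range g)) :
    Algebra.IsAlgebraic (Algebra.adjoin ℂ (Set.range g)) E := by
  refine ⟨fun y => ?_⟩
  have hy : y ∈ IntermediateField.adjoin ℂ s := hs ▸ IntermediateField.mem_top
  obtain ⟨a, ha, b, hb, rfl⟩ := IntermediateField.mem_adjoin_iff_div.1 hy
  have hle : Algebra.adjoin ℂ s ≤ Algebra.adjoin ℂ (Set.range g) := Algebra.adjoin_le h
  have h1 : ∀ a ∈ Algebra.adjoin ℂ s, IsAlgebraic (Algebra.adjoin ℂ (Set.range g)) a :=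
    fun a ha => isAlgebraic_algebraMap (⟨a, hle ha⟩ : Algebra.adjoin ℂ (Set.range g))
  rw [div_eq_mul_inv]
  exact (h1 a ha).mul (h1 b hb).inv

theorem trdeg_lt_card {E : Type} [Field E] [Algebra ℂ E] {s : Set E}
    (hs : IntermediateField.adjoin ℂ s = ⊤) {τ : Type} [Fintype τ] {g : τ → E}
    (h : s ⊆ Algebra.adjoin ℂ (Set.range g)) (hg : ¬ AlgebraicIndependent ℂ g) :
    Algebra.trdeg ℂ E < Fintype.card τ := by
  have := isAlgebraic_adjoin_range hs h
  rw [← Cardinal.mk_fintype]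
  by_contra! hle
  exact hg (Algebra.IsAlgebraic.isTranscendenceBasis_of_le_trdeg_of_finite ℂ g hle).1

theorem not_algebraicIndependent_of_eq_one {E : Type} [Field E] [Algebra ℂ E] {τ : Type}
    {g : τ → E} {q : τ} (hq : g q = 1) : ¬ AlgebraicIndependent ℂ g := fun h =>
  h.transcendental q (hq ▸ isAlgebraic_one)

theorem lin_sub {R : Type*} [CommRing R] {n : ℕ} (h h' : Fin n → R) :
    lin (h - h') = lin h - lin h' := by
  simp [lin, sub_mul, Finset.sum_sub_distrib]

theorem lin_smul {R : Type*} [CommRing R] {n : ℕ} (a : R) (h : Fin n → R) :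
    lin (a • h) = C a * lin h := by
  simp [lin, Finset.mul_sum, mul_assoc]

theorem lin_zero {R : Type*} [CommRing R] {n : ℕ} : lin (0 : Fin n → R) = 0 := by
  simp [lin]

theorem lin_injective {R : Type*} [CommRing R] {n : ℕ} :
    Function.Injective (lin : (Fin n → R) → MvPolynomial (Fin n) R) := fun h h' e => by
  funext j
  rw [← coeff_lin h, e, coeff_lin]

theorem lin_eq_zero_iff {R : Type*} [CommRing R] {n : ℕ} {h : Fin n → R} : lin h = 0 ↔ h = 0 := by
  rw [← lin_zero, lin_injective.eq_iff]

/-- The entries of `x` and `l` generate the field `E` over `ℂ`, and are normalised: `x` has a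
coordinate equal to `1`, the corresponding column of `l` is zero, and `l` has an entry equal
to `1`, outside the corresponding row if possible. -/
structure IsNormalized {n : ℕ} {E : Type} [Field E] [Algebra ℂ E] (x : Fin (n + 1) → E)
    (l : Matrix (Fin (n + 1)) (Fin (n + 1)) E) (k a b : Fin (n + 1)) : Prop where
  apply_eq_one : x k = 1
  col_eq_zero : ∀ i, l i k = 0
  entry_eq_one : l a b = 1
  row_ne : a ≠ k ∨ ∀ i, i ≠ k → ∀ j, l i j = 0
  adjoin_eq_top : IntermediateField.adjoin ℂ
    (Set.range x ∪ Set.range fun q : Fin (n + 1) × Fin (n + 1) => l q.1 q.2) = ⊤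

theorem lin_single {R : Type*} [CommRing R] {n : ℕ} (j : Fin n) :
    lin (Pi.single j (1 : R)) = X j := by
  classical
  simp [lin, Pi.single_apply, apply_ite C, ite_mul]

theorem lin_sum {R ι : Type*} [CommRing R] {n : ℕ} (s : Finset ι) (h : ι → Fin n → R) :
    lin (∑ i ∈ s, h i) = ∑ i ∈ s, lin (h i) := by
  simp only [lin, Finset.sum_apply, map_sum, Finset.sum_mul]
  exact Finset.sum_comm

theorem totalDegree_lin {R : Type*} [CommRing R] {n : ℕ} {v : Fin n → R} (hv : v ≠ 0) :
    (lin v).totalDegree = 1 :=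
  (isHomogeneous_lin v).totalDegree (mt lin_eq_zero_iff.1 hv)

theorem prime_lin {E : Type*} [Field E] {n : ℕ} {v : Fin n → E} (hv : v ≠ 0) :
    Prime (lin v) := by
  refine (irreducible_of_totalDegree_eq_one (totalDegree_lin hv) fun a ha => ?_).prime
  obtain ⟨j, hj⟩ := Function.ne_iff.1 hv
  refine isUnit_iff_ne_zero.2 fun h0 => hj ?_
  have := ha (Finsupp.single j 1)
  rw [coeff_lin, h0, zero_dvd_iff] at this
  exact this

theorem exists_smul_of_lin_dvd_lin {E : Type*} [Field E] {n : ℕ} {u v : Fin n → E}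
    (h : lin v ∣ lin u) : ∃ a : E, u = a • v := by
  by_cases hu : u = 0
  · exact ⟨0, by rw [hu, zero_smul]⟩
  obtain ⟨q, hq⟩ := h
  have hu0 := mt lin_eq_zero_iff.1 hu
  have hv0 : v ≠ 0 := by
    rintro rfl
    rw [lin_zero, zero_mul] at hq
    exact hu0 hq
  have hq0 : q ≠ 0 := by
    rintro rfl
    rw [mul_zero] at hq
    exact hu0 hq
  have h1 := totalDegree_mul_of_isDomain (mt lin_eq_zero_iff.1 hv0) hq0
  rw [← hq, totalDegree_lin hu, totalDegree_lin hv0] at h1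
  have h2 := totalDegree_eq_zero_iff_eq_C.1 (show q.totalDegree = 0 by omega)
  rw [h2, mul_comm, ← lin_smul] at hq
  exact ⟨_, lin_injective hq⟩

/-- If a derivation maps a prime `v` outside the ideal `(v)`, its kernel contains no nonzero
multiples of `v`. -/
theorem eq_zero_of_derivation_mul_eq_zero {E : Type*} [Field E] [CharZero E] {n : ℕ}
    (δ : Derivation E (MvPolynomial (Fin n) E) (MvPolynomial (Fin n) E))
    {v : MvPolynomial (Fin n) E} (hv : Prime v) (hδ : ¬ v ∣ δ v) {G : MvPolynomial (Fin n) E}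
    (h : δ (v * G) = 0) : G = 0 := by
  by_contra hG
  obtain ⟨H, hGH, hH⟩ := (FiniteMultiplicity.of_prime_left hv hG).exists_eq_pow_mul_and_not_dvd
  obtain ⟨m, hm⟩ : ∃ m, m = multiplicity v G := ⟨_, rfl⟩
  rw [← hm] at hGH
  rw [hGH] at h
  rw [← mul_assoc, ← pow_succ', Derivation.leibniz, Derivation.leibniz_pow] at h
  simp only [smul_eq_mul, nsmul_eq_mul, add_tsub_cancel_right] at h
  have h1 : v ^ m * (v * δ H + ((m + 1 : ℕ) : MvPolynomial (Fin n) E) * (H * δ v)) = 0 := by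
    rw [← h]
    ring
  have h2 := (mul_eq_zero.1 h1).resolve_left (pow_ne_zero _ hv.ne_zero)
  have h3 : v ∣ ((m + 1 : ℕ) : MvPolynomial (Fin n) E) * (H * δ v) :=
    ⟨-δ H, by linear_combination h2⟩
  rcases hv.dvd_or_dvd h3 with h4 | h4
  · have : IsUnit ((m + 1 : ℕ) : MvPolynomial (Fin n) E) := by
      rw [← map_natCast (C : E →+* _)]
      exact (isUnit_iff_ne_zero.2 (Nat.cast_ne_zero.2 m.succ_ne_zero)).map C
    exact hv.not_isUnit (isUnit_of_dvd_unit h4 this)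
  · exact (hv.dvd_or_dvd h4).elim hH hδ

section

open scoped Matrix

/-- The symmetric power of degree `k` of a subspace of linear forms, cut out among the forms of
degree `k` by the derivatives along the vectors orthogonal to the subspace. -/
def symSub {E : Type*} [Field E] {n : ℕ} (H : Submodule E (Fin n → E)) (k : ℕ) :
    Submodule E (MvPolynomial (Fin n) E) where
  carrier := {F | F.IsHomogeneous k ∧ ∀ θ : Fin n → E, (∀ h ∈ H, θ ⬝ᵥ h = 0) → dirDeriv θ F = 0}
  add_mem' := fun ha hb => ⟨ha.1.add hb.1, fun θ hθ => by
    rw [map_add, ha.2 θ hθ, hb.2 θ hθ, add_zero]⟩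
  zero_mem' := ⟨isHomogeneous_zero _ _ _, fun θ _ => map_zero _⟩
  smul_mem' := fun a F hF => ⟨(homogeneousSubmodule _ E k).smul_mem a hF.1, fun θ hθ => by
    rw [Derivation.map_smul, hF.2 θ hθ, smul_zero]⟩

theorem mul_mem_symSub {E : Type*} [Field E] {n : ℕ} {H : Submodule E (Fin n → E)} {i j : ℕ}
    {F G : MvPolynomial (Fin n) E} (hF : F ∈ symSub H i) (hG : G ∈ symSub H j) :
    F * G ∈ symSub H (i + j) :=
  ⟨hF.1.mul hG.1, fun θ hθ => by rw [Derivation.leibniz, hF.2 θ hθ, hG.2 θ hθ]; simp⟩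

theorem lin_mem_symSub {E : Type*} [Field E] {n : ℕ} {H : Submodule E (Fin n → E)}
    {h : Fin n → E} (hh : h ∈ H) : lin h ∈ symSub H 1 :=
  ⟨isHomogeneous_lin h, fun θ hθ => by rw [dirDeriv_lin, hθ h hh, C_0]⟩

instance {E : Type*} [Field E] {n : ℕ} (H : Submodule E (Fin n → E)) (k : ℕ) :
    Module.Finite E (symSub H k) := by
  let κ : symSub H k →ₗ[E] (Mon n k → E) :=
    (LinearMap.pi fun m => lcoeff E m.1).comp (symSub H k).subtype
  refine Module.Finite.of_injective κ ((injective_iff_map_eq_zero κ).2 fun F hF => ?_)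
  apply Subtype.ext
  rw [← formOf_coeff F.2.1, show (fun m : Mon n k => coeff m.1 F.1) = 0 from hF]
  simp [formOf]

theorem choose_le_finrank_symSub {E : Type*} [Field E] {n m : ℕ} {H : Submodule E (Fin n → E)}
    (hm : m ≤ Module.finrank E H) (k : ℕ) :
    (m + k - 1).choose k ≤ Module.finrank E (symSub H k) := by
  let r := Module.finrank E H
  let b : Module.Basis (Fin r) E H := Module.finBasis E H
  let ι : MvPolynomial (Fin r) E →ₐ[E] MvPolynomial (Fin n) E :=
    aeval fun i => lin (b i : Fin n → E)
  obtain ⟨L, hL⟩ := (H.subtype.comp b.equivFun.symm.toLinearMap).exists_leftInverse_of_injective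
    (LinearMap.ker_eq_bot.2 (H.injective_subtype.comp b.equivFun.symm.injective))
  let ρ : MvPolynomial (Fin n) E →ₐ[E] MvPolynomial (Fin r) E :=
    aeval fun j => lin (L (Pi.single j 1))
  have hρlin : ∀ h, ρ (lin h) = lin (L h) := by
    intro h
    have h1 : h = ∑ j, h j • Pi.single j (1 : E) := by simpa using pi_eq_sum_univ' h
    have h2 : L h = ∑ j, h j • L (Pi.single j 1) := by
      conv_lhs => rw [h1]
      simp only [map_sum, map_smul]
    rw [h2, lin_sum]
    simp only [lin_smul]
    rw [lin, map_sum]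
    refine Finset.sum_congr rfl fun j _ => ?_
    rw [map_mul, aeval_X, algHom_C, algebraMap_eq]
  have hρι : ∀ P, ρ (ι P) = P := by
    intro P
    have : ρ.comp ι = AlgHom.id E _ := by
      ext i : 1
      simp only [ι, AlgHom.comp_apply, aeval_X, hρlin, AlgHom.id_apply]
      rw [← lin_single]
      congr 1
      have := LinearMap.congr_fun hL (Pi.single i 1)
      simpa using this
    exact AlgHom.congr_fun this P
  have hι : ∀ P, P.IsHomogeneous k → ι P ∈ symSub H k := by
    intro P hP
    refine ⟨one_mul k ▸ hP.aeval _ fun i => isHomogeneous_lin (b i : Fin n → E), fun θ hθ => ?_⟩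
    clear hP
    induction P using MvPolynomial.induction_on with
    | C a => simp [ι]
    | add p q hp hq => rw [map_add, map_add, hp, hq, add_zero]
    | mul_X p i hp =>
      rw [map_mul, Derivation.leibniz, hp]
      simp [ι, dirDeriv_lin, hθ]
  let γ : (Mon r k → E) →ₗ[E] symSub H k :=
    { toFun := fun c => ⟨ι (formOf c), hι _ (isHomogeneous_formOf c)⟩
      map_add' := fun c c' => Subtype.ext (by simp [formOf, Finset.sum_add_distrib])
      map_smul' := fun a c => Subtype.ext (by
        simp [formOf, Finset.smul_sum, ← map_smul]) }
  have hγ : Function.Injective γ := fun c c' h => by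
    have h1 : ι (formOf c) = ι (formOf c') := congrArg Subtype.val h
    have h2 : formOf c = formOf c' := by rw [← hρι (formOf c), h1, hρι]
    funext q
    rw [← coeff_formOf c, h2, coeff_formOf]
  have h1 := LinearMap.finrank_le_finrank_of_injective hγ
  rw [Module.finrank_fintype_fun_eq_card, Fintype.card_coe,
    Finset.card_finsuppAntidiag_nat_eq_choose, Finset.card_univ, Fintype.card_fin] at h1
  exact (Nat.choose_le_choose k (by omega)).trans h1

theorem linDeriv_eq_sum_X_mul_dirDeriv {R : Type*} [CommRing R] {n : ℕ}
    (l : Matrix (Fin n) (Fin n) R) (P : MvPolynomial (Fin n) R) :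
    linDeriv l P = ∑ i, X i * dirDeriv (l i) P := by
  simp only [linDeriv_apply, dirDeriv_apply, lin, Finset.sum_mul, Finset.mul_sum]
  rw [Finset.sum_comm]
  exact Finset.sum_congr rfl fun i _ => Finset.sum_congr rfl fun j _ => by ring

theorem dirDeriv_sub {R : Type*} [CommRing R] {n : ℕ} (x y : Fin n → R)
    (P : MvPolynomial (Fin n) R) : dirDeriv (x - y) P = dirDeriv x P - dirDeriv y P := by
  simp [dirDeriv_apply, sub_mul]

theorem dirDeriv_smul_single {R : Type*} [CommRing R] {n : ℕ} (a : R) (i : Fin n)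
    (P : MvPolynomial (Fin n) R) : dirDeriv (a • Pi.single i 1) P = C a * pderiv i P := by
  classical
  simp [dirDeriv_apply, Pi.single_apply, apply_ite C]

theorem dirDeriv_vecMul {R : Type*} [CommRing R] {n : ℕ} (x : Fin n → R)
    (l : Matrix (Fin n) (Fin n) R) (P : MvPolynomial (Fin n) R) :
    dirDeriv (x ᵥ* l) P = dirDeriv x (linDeriv l P) - linDeriv l (dirDeriv x P) := by
  rw [← Derivation.commutator_apply]
  refine Derivation.congr_fun (derivation_ext fun j => ?_) P
  rw [Derivation.commutator_apply, ← lin_single, dirDeriv_lin, linDeriv_lin, dirDeriv_lin,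
    dirDeriv_lin, Matrix.dotProduct_mulVec]
  simp

theorem dirDeriv_vecMul_eq_zero {R : Type*} [CommRing R] {n : ℕ} {x : Fin n → R}
    {l : Matrix (Fin n) (Fin n) R} {P : MvPolynomial (Fin n) R} (h1 : dirDeriv x P = 0)
    (h2 : linDeriv l P = 0) : dirDeriv (x ᵥ* l) P = 0 := by
  rw [dirDeriv_vecMul, h1, h2, map_zero, map_zero, sub_zero]

theorem linDeriv_eq_of_forall_mulVec_eq_smul {E : Type*} [Field E] {n k : ℕ}
    {H : Submodule E (Fin n → E)} {l : Matrix (Fin n) (Fin n) E} {a : E}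
    (h : ∀ v ∈ H, l *ᵥ v = a • v) {F : MvPolynomial (Fin n) E} (hF : F ∈ symSub H k) :
    linDeriv l F = C (a * k) * F := by
  have h1 : ∀ i, dirDeriv (l i) F = C a * pderiv i F := fun i => by
    rw [← sub_eq_zero, ← dirDeriv_smul_single, ← dirDeriv_sub]
    refine hF.2 _ fun v hv => ?_
    have := congrFun (h v hv) i
    rw [Matrix.mulVec] at this
    rw [sub_dotProduct, this, smul_dotProduct, single_one_dotProduct]
    simp
  rw [linDeriv_eq_sum_X_mul_dirDeriv]
  have h2 := hF.1.sum_X_mul_pderiv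
  calc _ = C a * ∑ i, X i * pderiv i F := by
        rw [Finset.mul_sum]
        exact Finset.sum_congr rfl fun i _ => by rw [h1]; ring
    _ = _ := by rw [h2, nsmul_eq_mul, C_mul, map_natCast]; ring

theorem exists_forall_linDeriv_mul_eq_zero {E : Type*} [Field E] [CharZero E] {n : ℕ}
    {H : Submodule E (Fin n → E)} {l : Matrix (Fin n) (Fin n) E} (h : ∃ v ∈ H, l *ᵥ v ≠ 0) :
    ∃ v ∈ H, v ≠ 0 ∧ ∀ (k : ℕ), ∀ G ∈ symSub H k, linDeriv l (lin v * G) = 0 → G = 0 := by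
  by_cases hl : ∀ v ∈ H, ∃ a : E, l *ᵥ v = a • v
  · have hm : ∀ v ∈ H, l.mulVecLin v ∈ H := fun v hv => by
      obtain ⟨a, ha⟩ := hl v hv
      rw [Matrix.mulVecLin_apply, ha]
      exact H.smul_mem a hv
    obtain ⟨a, ha⟩ := LinearMap.exists_eq_smul_id_of_forall_notLinearIndependent
      (f := l.mulVecLin.restrict hm) (by
        rintro ⟨v, hv⟩ hv2
        obtain ⟨a, ha⟩ := hl v hv
        have h2 := LinearIndependent.pair_iff.1 hv2 a (-1) (by
          apply Subtype.ext
          simp [ha])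
        simpa using h2.2)
    have ha' : ∀ v ∈ H, l *ᵥ v = a • v := fun v hv =>
      congrArg Subtype.val (LinearMap.congr_fun ha ⟨v, hv⟩)
    obtain ⟨v, hv, hv0⟩ := h
    have ha0 : a ≠ 0 := by
      rintro rfl
      rw [ha' v hv, zero_smul] at hv0
      exact hv0 rfl
    have hv1 : v ≠ 0 := by
      rintro rfl
      rw [Matrix.mulVec_zero] at hv0
      exact hv0 rfl
    refine ⟨v, hv, hv1, fun k G hG h0 => ?_⟩
    rw [linDeriv_eq_of_forall_mulVec_eq_smul ha' (mul_mem_symSub (lin_mem_symSub hv) hG)] at h0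
    have h1 : (C (a * ((1 + k : ℕ) : E)) : MvPolynomial (Fin n) E) ≠ 0 := by
      rw [Ne, C_eq_zero]
      exact mul_ne_zero ha0 (Nat.cast_ne_zero.2 (by omega))
    exact (mul_eq_zero.1 ((mul_eq_zero.1 h0).resolve_left h1)).resolve_left
      (mt lin_eq_zero_iff.1 hv1)
  · push Not at hl
    obtain ⟨v, hv, hl⟩ := hl
    have hv1 : v ≠ 0 := by
      rintro rfl
      exact hl 0 (by simp)
    refine ⟨v, hv, hv1, fun k G _ h0 => ?_⟩
    refine eq_zero_of_derivation_mul_eq_zero (linDeriv l) (prime_lin hv1) (fun h1 => ?_) h0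
    rw [linDeriv_lin] at h1
    obtain ⟨a, ha⟩ := exists_smul_of_lin_dvd_lin h1
    exact hl a ha

/-- The vectors orthogonal to the rows of a matrix. -/
def perp {E : Type*} [Field E] {m n : ℕ} (A : Matrix (Fin m) (Fin n) E) :
    Submodule E (Fin n → E) :=
  LinearMap.ker A.mulVecLin

theorem mem_perp {E : Type*} [Field E] {m n : ℕ} {A : Matrix (Fin m) (Fin n) E} {h : Fin n → E} :
    h ∈ perp A ↔ ∀ i, A i ⬝ᵥ h = 0 := by
  rw [perp, LinearMap.mem_ker, Matrix.mulVecLin_apply, funext_iff]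
  rfl

theorem le_finrank_perp {E : Type*} [Field E] {m n : ℕ} (A : Matrix (Fin m) (Fin n) E) :
    n ≤ Module.finrank E (perp A) + m := by
  have h1 := A.mulVecLin.finrank_range_add_finrank_ker
  have h2 := Submodule.finrank_le (LinearMap.range A.mulVecLin)
  rw [Module.finrank_fin_fun] at h1 h2
  rw [perp]
  omega

theorem dirDeriv_eq_zero_of_mem_symSub {E : Type*} [Field E] {m n k : ℕ}
    {A : Matrix (Fin m) (Fin n) E} {F : MvPolynomial (Fin n) E} (hF : F ∈ symSub (perp A) k)
    (i : Fin m) : dirDeriv (A i) F = 0 :=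
  hF.2 _ fun _ hv => mem_perp.1 hv i

/-- Multiplication by a linear form, on the symmetric power of a subspace of linear forms. -/
def linMul {E : Type*} [Field E] {n : ℕ} (v : Fin n → E) (H : Submodule E (Fin n → E)) (k : ℕ) :
    symSub H k →ₗ[E] MvPolynomial (Fin n) E :=
  (LinearMap.mulLeft E (lin v)).comp (symSub H k).subtype

theorem linMul_apply {E : Type*} [Field E] {n : ℕ} (v : Fin n → E) (H : Submodule E (Fin n → E))
    (k : ℕ) (G : symSub H k) : linMul v H k G = lin v * G := rfl

theorem hasRank_of_mulVec_ne_zero {E : Type*} [Field E] [CharZero E] {n k : ℕ}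
    {x : Fin (n + 1) → E} {l : Matrix (Fin (n + 1)) (Fin (n + 1)) E}
    (h : ∃ v ∈ perp ![x], l *ᵥ v ≠ 0) : HasRank x l (k + 1) ((n + k - 1).choose k) := by
  obtain ⟨v, hv, hv0, hl⟩ := exists_forall_linDeriv_mul_eq_zero h
  have hm : ∀ G : symSub (perp ![x]) k, linMul v _ k G ∈ symSub (perp ![x]) (1 + k) := fun G =>
    mul_mem_symSub (lin_mem_symSub hv) G.2
  refine HasRank.of_linearMap (linMul v _ k) (fun G => add_comm 1 k ▸ (hm G).1)
    (fun G => dirDeriv_eq_zero_of_mem_symSub (hm G) 0)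
    (fun G hG => Subtype.ext (hl k G G.2 hG)) (choose_le_finrank_symSub ?_ k)
  have := le_finrank_perp ![x]
  omega

theorem hasRank_of_mulVec_ne_zero_of_dotProduct_ne_zero {E : Type*} [Field E] [CharZero E]
    {n k : ℕ} {x : Fin (n + 2) → E} {l : Matrix (Fin (n + 2)) (Fin (n + 2)) E}
    (hφ : ∃ y, x ⬝ᵥ y = 0 ∧ (x ᵥ* l) ⬝ᵥ y ≠ 0) (h : ∃ v ∈ perp ![x, x ᵥ* l], l *ᵥ v ≠ 0) :
    HasRank x l (k + 1) ((n + 1 + k - 1).choose k + (n + k - 1).choose k) := by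
  obtain ⟨v, hv, hv0, hl⟩ := exists_forall_linDeriv_mul_eq_zero h
  obtain ⟨y, hy, hφy⟩ := hφ
  have hy0 : y ≠ 0 := by
    rintro rfl
    simp at hφy
  have hy' : y ∈ perp ![x] := mem_perp.2 fun i => by
    rw [Subsingleton.elim i 0]
    exact hy
  have hm : ∀ G : symSub (perp ![x]) k, linMul y _ k G ∈ symSub (perp ![x]) (1 + k) := fun G =>
    mul_mem_symSub (lin_mem_symSub hy') G.2
  have hm' : ∀ G : symSub (perp ![x, x ᵥ* l]) k,
      linMul v _ k G ∈ symSub (perp ![x, x ᵥ* l]) (1 + k) := fun G =>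
    mul_mem_symSub (lin_mem_symSub hv) G.2
  have hxy : ∀ G : symSub (perp ![x]) k, dirDeriv x (linMul y _ k G) = 0 := fun G =>
    dirDeriv_eq_zero_of_mem_symSub (hm G) 0
  have hxv : ∀ G : symSub (perp ![x, x ᵥ* l]) k, dirDeriv x (linMul v _ k G) = 0 := fun G =>
    dirDeriv_eq_zero_of_mem_symSub (hm' G) 0
  have hφv : ∀ G : symSub (perp ![x, x ᵥ* l]) k, dirDeriv (x ᵥ* l) (linMul v _ k G) = 0 :=
    fun G => dirDeriv_eq_zero_of_mem_symSub (hm' G) 1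
  have hx : ∀ G G', dirDeriv x (linMul y (perp ![x]) k G +
      linMul v (perp ![x, x ᵥ* l]) k G') = 0 := fun G G' => by
    rw [map_add, hxy, hxv, add_zero]
  have hd : ∀ G G', (linMul y (perp ![x]) k G +
      linMul v (perp ![x, x ᵥ* l]) k G').IsHomogeneous (k + 1) := fun G G' => by
    rw [add_comm k]
    exact (hm G).1.add (hm' G').1
  refine HasRank.of_linearMap ((linMul y (perp ![x]) k).coprod (linMul v (perp ![x, x ᵥ* l]) k))
    (fun G => hd G.1 G.2) (fun G => hx G.1 G.2) ?_ ?_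
  · rintro ⟨G, G'⟩ hG
    rw [LinearMap.coprod_apply] at hG
    have h1 := dirDeriv_vecMul_eq_zero (hx G G') hG
    rw [map_add, hφv, add_zero, linMul_apply] at h1
    have h2 := eq_zero_of_derivation_mul_eq_zero _ (prime_lin hy0) (fun h2 => by
      rw [dirDeriv_lin] at h2
      exact (prime_lin hy0).not_isUnit
        (isUnit_of_dvd_unit h2 ((isUnit_iff_ne_zero.2 hφy).map C))) h1
    obtain rfl : G = 0 := Subtype.ext h2
    rw [map_zero, zero_add] at hG
    obtain rfl : G' = 0 := Subtype.ext (hl k G' G'.2 hG)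
    rfl
  · rw [Module.finrank_prod]
    have h1 := le_finrank_perp ![x]
    have h2 := le_finrank_perp ![x, x ᵥ* l]
    exact add_le_add (choose_le_finrank_symSub (by omega) k)
      (choose_le_finrank_symSub (by omega) k)

/-- The matrix with rows `x * l ^ i`. -/
def krylov {R : Type*} [CommRing R] {n : ℕ} (x : Fin n → R) (l : Matrix (Fin n) (Fin n) R) :
    Matrix (Fin n) (Fin n) R :=
  Matrix.of fun i => x ᵥ* l ^ (i : ℕ)

theorem dirDeriv_vecMul_matrix {R : Type*} [CommRing R] {n : ℕ} (y : Fin n → R)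
    (A : Matrix (Fin n) (Fin n) R) (P : MvPolynomial (Fin n) R) :
    dirDeriv (y ᵥ* A) P = ∑ i, C (y i) * dirDeriv (A i) P := by
  simp only [dirDeriv_apply, Matrix.vecMul, dotProduct, map_sum, map_mul, Finset.sum_mul,
    Finset.mul_sum]
  rw [Finset.sum_comm]
  exact Finset.sum_congr rfl fun i _ => Finset.sum_congr rfl fun j _ => by ring

theorem eq_zero_of_forall_pderiv_eq_zero {R : Type*} [CommRing R] [IsDomain R] [CharZero R]
    {n d : ℕ} (hd : d ≠ 0) {P : MvPolynomial (Fin n) R} (hP : P.IsHomogeneous d)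
    (h : ∀ i, pderiv i P = 0) : P = 0 := by
  have := hP.sum_X_mul_pderiv
  simp only [h, mul_zero, Finset.sum_const_zero, nsmul_eq_mul] at this
  rcases mul_eq_zero.1 this.symm with h0 | h0
  · exact absurd h0 (Nat.cast_ne_zero.2 hd)
  · exact h0

theorem dirDeriv_vecMul_pow_eq_zero {R : Type*} [CommRing R] {n : ℕ} {x : Fin n → R}
    {l : Matrix (Fin n) (Fin n) R} {P : MvPolynomial (Fin n) R} (h1 : dirDeriv x P = 0)
    (h2 : linDeriv l P = 0) (i : ℕ) : dirDeriv (x ᵥ* l ^ i) P = 0 := by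
  induction i with
  | zero => simpa using h1
  | succ i ih =>
    rw [pow_succ, ← Matrix.vecMul_vecMul]
    exact dirDeriv_vecMul_eq_zero ih h2

theorem hasRank_of_det_krylov_ne_zero {E : Type*} [Field E] [CharZero E] {n k : ℕ}
    {x : Fin (n + 1) → E} {l : Matrix (Fin (n + 1)) (Fin (n + 1)) E}
    (h : (krylov x l).det ≠ 0) : HasRank x l (k + 1) ((n + (k + 1) - 1).choose (k + 1)) := by
  refine HasRank.of_linearMap (symSub (perp ![x]) (k + 1)).subtype (fun F => F.2.1)
    (fun F => dirDeriv_eq_zero_of_mem_symSub F.2 0) (fun F hF => Subtype.ext ?_)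
    (choose_le_finrank_symSub (by have := le_finrank_perp ![x]; omega) _)
  refine eq_zero_of_forall_pderiv_eq_zero k.succ_ne_zero F.2.1 fun i => ?_
  have h1 : Pi.single i 1 = (Pi.single i 1 ᵥ* (krylov x l)⁻¹) ᵥ* krylov x l := by
    rw [Matrix.vecMul_vecMul, Matrix.nonsing_inv_mul _ (isUnit_iff_ne_zero.2 h), Matrix.vecMul_one]
  have h2 : pderiv i (F : MvPolynomial (Fin (n + 1)) E) =
      dirDeriv (Pi.single i (1 : E)) (F : MvPolynomial (Fin (n + 1)) E) := by
    have := dirDeriv_smul_single (1 : E) i (F : MvPolynomial (Fin (n + 1)) E)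
    rw [one_smul, C_1, one_mul] at this
    exact this.symm
  rw [h2, h1, dirDeriv_vecMul_matrix]
  have hx : dirDeriv x (F : MvPolynomial (Fin (n + 1)) E) = 0 :=
    dirDeriv_eq_zero_of_mem_symSub F.2 0
  exact Finset.sum_eq_zero fun j _ => by
    rw [show krylov x l j = x ᵥ* l ^ (j : ℕ) from rfl, dirDeriv_vecMul_pow_eq_zero hx hF, mul_zero]

theorem eval_lin {R : Type*} [CommRing R] {n : ℕ} (p h : Fin n → R) :
    eval p (lin h) = h ⬝ᵥ p := by
  simp [lin, dotProduct]

theorem exists_dotProduct_eq {E : Type*} [Field E] {m n : ℕ} {w : Fin m → Fin n → E}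
    (hw : LinearIndependent E w) (c : Fin m → E) : ∃ p, ∀ i, w i ⬝ᵥ p = c i := by
  have h1 : LinearIndependent E (Matrix.of w).row := hw
  have h2 : LinearMap.range (Matrix.of w).mulVecLin = ⊤ := by
    refine Submodule.eq_top_of_finrank_eq ?_
    rw [Module.finrank_fin_fun]
    exact h1.rank_matrix.trans (Fintype.card_fin m)
  obtain ⟨p, hp⟩ := LinearMap.range_eq_top.1 h2 c
  exact ⟨p, fun i => congrFun hp i⟩

theorem eq_zero_of_linDeriv_cyclic {E : Type*} [Field E] [CharZero E] {n : ℕ}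
    {l : Matrix (Fin n) (Fin n) E} {v u w : Fin n → E} (huv : l *ᵥ v = u) (hwu : l *ᵥ u = w)
    (hw : LinearIndependent E ![v, u, w]) {G : MvPolynomial (Fin n) E} {s t : E}
    (h : linDeriv l (lin v * G + (s • (lin u * lin w ^ 3) + t • (lin u ^ 3 * lin w))) = 0) :
    G = 0 ∧ s = 0 ∧ t = 0 := by
  obtain ⟨p, hp⟩ := exists_dotProduct_eq hw ![0, 0, 1]
  have hpv : eval p (lin v) = 0 := (eval_lin p v).trans (hp 0)
  have hpu : eval p (lin u) = 0 := (eval_lin p u).trans (hp 1)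
  have hpw : eval p (lin w) = 1 := (eval_lin p w).trans (hp 2)
  have hv0 : v ≠ 0 := hw.ne_zero 0
  have hvu : ¬ lin v ∣ lin u := fun h1 => by
    obtain ⟨a, ha⟩ := exists_smul_of_lin_dvd_lin h1
    obtain ⟨q, hq⟩ := exists_dotProduct_eq hw ![0, 1, 0]
    have h2 : u ⬝ᵥ q = 1 := hq 1
    rw [ha, smul_dotProduct, show v ⬝ᵥ q = 0 from hq 0, smul_zero] at h2
    exact zero_ne_one h2
  have hDv : linDeriv l (lin v) = lin u := by rw [linDeriv_lin, huv]
  have hDu : linDeriv l (lin u) = lin w := by rw [linDeriv_lin, hwu]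
  have hpr := prime_lin hv0
  generalize lin v = V at *
  generalize lin u = U at *
  generalize lin w = W at *
  generalize linDeriv l = D at *
  simp only [map_add, Derivation.leibniz, Derivation.leibniz_pow, smul_eq_mul,
    hDv, hDu, smul_eq_C_mul, nsmul_eq_mul] at h
  norm_num at h
  have hs : s = 0 := by
    have := congrArg (eval p) h
    simp only [map_add, map_mul, map_pow, hpv, hpu, hpw, eval_C, map_zero] at this
    simpa using this
  subst hs
  rw [C_0] at h
  obtain ⟨G1, hG1⟩ : V ∣ G + C t * (3 * U * W ^ 2 + U ^ 2 * D W) :=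
    (hpr.dvd_or_dvd (show V ∣ U * (G + C t * (3 * U * W ^ 2 + U ^ 2 * D W)) from
      ⟨-D G, by linear_combination h⟩)).resolve_left hvu
  have hDG := congrArg D hG1
  simp only [map_add, Derivation.leibniz, Derivation.leibniz_pow, smul_eq_mul, hDv, hDu,
    nsmul_eq_mul, derivation_C] at hDG
  have h3 : D 3 = 0 := by simpa using D.map_natCast 3
  norm_num [h3] at hDG
  have ht : t = 0 := by
    have h1 : V * (2 * U * G1 + V * D G1 -
        C t * (3 * W ^ 3 + 8 * U * W * D W + U ^ 2 * D (D W))) = 0 := by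
      linear_combination h + V * hDG.symm + U * hG1.symm
    have h2 := (mul_eq_zero.1 h1).resolve_left hpr.ne_zero
    have := congrArg (eval p) h2
    simp only [map_add, map_sub, map_mul, map_pow, hpv, hpu, hpw, eval_C, map_zero] at this
    simpa using this
  subst ht
  refine ⟨eq_zero_of_derivation_mul_eq_zero D hpr (hDv ▸ hvu) ?_, rfl, rfl⟩
  rw [C_0] at h
  rw [Derivation.leibniz, smul_eq_mul, smul_eq_mul, hDv]
  linear_combination h

theorem hasRank_of_cyclic {E : Type*} [Field E] [CharZero E]
    {x : Fin 4 → E} {l : Matrix (Fin 4) (Fin 4) E} {v u w : Fin 4 → E} (huv : l *ᵥ v = u)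
    (hwu : l *ᵥ u = w) (hv : v ∈ perp ![x]) (hu : u ∈ perp ![x]) (hw : w ∈ perp ![x])
    (h : LinearIndependent E ![v, u, w]) : HasRank x l 4 12 := by
  have h1 : lin u * lin w ^ 3 ∈ symSub (perp ![x]) 4 := by
    have := mul_mem_symSub (lin_mem_symSub hu) (mul_mem_symSub (lin_mem_symSub hw)
      (mul_mem_symSub (lin_mem_symSub hw) (lin_mem_symSub hw)))
    convert this using 1
    ring
  have h2 : lin u ^ 3 * lin w ∈ symSub (perp ![x]) 4 := by
    have := mul_mem_symSub (lin_mem_symSub hw) (mul_mem_symSub (lin_mem_symSub hu)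
      (mul_mem_symSub (lin_mem_symSub hu) (lin_mem_symSub hu)))
    convert this using 1
    ring
  have hm : ∀ (G : symSub (perp ![x]) 3) (s t : E),
      linMul v (perp ![x]) 3 G + (s • (lin u * lin w ^ 3) + t • (lin u ^ 3 * lin w)) ∈
        symSub (perp ![x]) 4 := fun G s t =>
    add_mem (mul_mem_symSub (lin_mem_symSub hv) G.2)
      (add_mem (Submodule.smul_mem _ _ h1) (Submodule.smul_mem _ _ h2))
  let β : symSub (perp ![x]) 3 × E × E →ₗ[E] MvPolynomial (Fin 4) E :=
    (linMul v (perp ![x]) 3).coprod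
      ((LinearMap.toSpanSingleton E _ (lin u * lin w ^ 3)).coprod
        (LinearMap.toSpanSingleton E _ (lin u ^ 3 * lin w)))
  have hβ : ∀ G s t, β (G, s, t) = linMul v (perp ![x]) 3 G +
      (s • (lin u * lin w ^ 3) + t • (lin u ^ 3 * lin w)) := fun G s t => by
    simp only [β, LinearMap.coprod_apply, LinearMap.toSpanSingleton_apply]
  clear_value β
  refine HasRank.of_linearMap β (fun ⟨G, s, t⟩ => ?_) (fun ⟨G, s, t⟩ => ?_)
    (fun ⟨G, s, t⟩ h0 => ?_) ?_
  · rw [hβ]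
    exact (hm G s t).1
  · rw [hβ]
    exact dirDeriv_eq_zero_of_mem_symSub (hm G s t) 0
  · rw [hβ] at h0
    obtain ⟨hG, rfl, rfl⟩ := eq_zero_of_linDeriv_cyclic huv hwu h h0
    obtain rfl : G = 0 := Subtype.ext hG
    rfl
  · rw [Module.finrank_prod, Module.finrank_prod, Module.finrank_self]
    have := choose_le_finrank_symSub (m := 3) (by have := le_finrank_perp ![x]; omega :
      3 ≤ Module.finrank E (perp ![x])) 3
    have h10 : Nat.choose (3 + 3 - 1) 3 = 10 := by decide
    omega

theorem IsNormalized.exists_succAbove_eq {n : ℕ} {E : Type} [Field E] [Algebra ℂ E]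
    {x : Fin (n + 1) → E} {l : Matrix (Fin (n + 1)) (Fin (n + 1)) E} {k a b : Fin (n + 1)}
    (h : IsNormalized x l k a b) : ∃ q, k.succAbove q = b :=
  Fin.exists_succAbove_eq fun hb => zero_ne_one ((h.col_eq_zero a).symm.trans (hb ▸ h.entry_eq_one))

theorem IsNormalized.subset_adjoin {n : ℕ} {E : Type} [Field E] [Algebra ℂ E]
    {x : Fin (n + 1) → E} {l : Matrix (Fin (n + 1)) (Fin (n + 1)) E} {k a b : Fin (n + 1)}
    (h : IsNormalized x l k a b) {A : Subalgebra ℂ E} (hx : ∀ j, x (k.succAbove j) ∈ A)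
    (hl : ∀ i j, l i (k.succAbove j) ∈ A) :
    (Set.range x ∪ Set.range fun q : Fin (n + 1) × Fin (n + 1) => l q.1 q.2) ⊆ A := by
  rintro _ (⟨i, rfl⟩ | ⟨⟨i, j⟩, rfl⟩)
  · rcases Fin.eq_self_or_eq_succAbove k i with rfl | ⟨i, rfl⟩
    · rw [h.apply_eq_one]
      exact A.one_mem
    · exact hx i
  · rcases Fin.eq_self_or_eq_succAbove k j with rfl | ⟨j, rfl⟩
    · change l i j ∈ A
      rw [h.col_eq_zero]
      exact A.zero_mem
    · exact hl i j

theorem IsNormalized.trdeg_lt {n : ℕ} {E : Type} [Field E] [Algebra ℂ E]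
    {x : Fin (n + 1) → E} {l : Matrix (Fin (n + 1)) (Fin (n + 1)) E} {k a b : Fin (n + 1)}
    (h : IsNormalized x l k a b) : Algebra.trdeg ℂ E < (n + (n + 1) * n : ℕ) := by
  obtain ⟨q, hq⟩ := h.exists_succAbove_eq
  let g : Fin n ⊕ Fin (n + 1) × Fin n → E :=
    Sum.elim (fun j => x (k.succAbove j)) fun p => l p.1 (k.succAbove p.2)
  have h1 := trdeg_lt_card h.adjoin_eq_top (g := g) (h.subset_adjoin
    (fun j => Algebra.subset_adjoin ⟨Sum.inl j, rfl⟩)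
    (fun i j => Algebra.subset_adjoin ⟨Sum.inr (i, j), rfl⟩))
    (not_algebraicIndependent_of_eq_one (q := Sum.inr (a, q)) (by
      simp only [g, Sum.elim_inr, hq, h.entry_eq_one]))
  simpa using h1

theorem IsNormalized.vecMul_apply_succAbove {n : ℕ} {E : Type} [Field E] [Algebra ℂ E]
    {x : Fin (n + 1) → E} {l : Matrix (Fin (n + 1)) (Fin (n + 1)) E} {k a b : Fin (n + 1)}
    (h : IsNormalized x l k a b) (j : Fin (n + 1)) :
    (x ᵥ* l) j = l k j + ∑ i, x (k.succAbove i) * l (k.succAbove i) j := by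
  rw [Matrix.vecMul, dotProduct, Fin.sum_univ_succAbove _ k, h.apply_eq_one, one_mul]

theorem IsNormalized.trdeg_lt_of_vecMul_eq_zero {n : ℕ} {E : Type} [Field E] [Algebra ℂ E]
    {x : Fin (n + 1) → E} {l : Matrix (Fin (n + 1)) (Fin (n + 1)) E} {k a b : Fin (n + 1)}
    (h : IsNormalized x l k a b) (h0 : x ᵥ* l = 0) :
    Algebra.trdeg ℂ E < (n + n * n : ℕ) := by
  obtain ⟨q, hq⟩ := h.exists_succAbove_eq
  have hφ : ∀ j, l k j = - ∑ i, x (k.succAbove i) * l (k.succAbove i) j := fun j =>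
    eq_neg_of_add_eq_zero_left ((h.vecMul_apply_succAbove j).symm.trans (congrFun h0 j))
  obtain ⟨p, hp⟩ := Fin.exists_succAbove_eq (x := a) (y := k) (by
    refine h.row_ne.elim id fun h1 => ?_
    rintro rfl
    have h2 := hφ b
    rw [h.entry_eq_one, Finset.sum_eq_zero fun i _ => by rw [h1 _ (Fin.succAbove_ne _ _), mul_zero],
      neg_zero] at h2
    exact one_ne_zero h2)
  let g : Fin n ⊕ Fin n × Fin n → E :=
    Sum.elim (fun j => x (k.succAbove j)) fun p => l (k.succAbove p.1) (k.succAbove p.2)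
  have hx : ∀ j, x (k.succAbove j) ∈ Algebra.adjoin ℂ (Set.range g) := fun j =>
    Algebra.subset_adjoin ⟨Sum.inl j, rfl⟩
  have hl : ∀ i j, l (k.succAbove i) (k.succAbove j) ∈ Algebra.adjoin ℂ (Set.range g) :=
    fun i j => Algebra.subset_adjoin ⟨Sum.inr (i, j), rfl⟩
  have h1 := trdeg_lt_card h.adjoin_eq_top (g := g) (h.subset_adjoin hx (fun i j => by
      rcases Fin.eq_self_or_eq_succAbove k i with rfl | ⟨i, rfl⟩
      · rw [hφ]
        exact neg_mem (sum_mem fun i' _ => mul_mem (hx i') (hl i' j))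
      · exact hl i j))
    (not_algebraicIndependent_of_eq_one (q := Sum.inr (p, q)) (by
      simp only [g, Sum.elim_inr, hq, hp, h.entry_eq_one]))
  simpa using h1

theorem IsNormalized.trdeg_lt_of_eq_add {n : ℕ} {E : Type} [Field E] [Algebra ℂ E]
    {x : Fin (n + 1) → E} {l : Matrix (Fin (n + 1)) (Fin (n + 1)) E} {k a b : Fin (n + 1)}
    (h : IsNormalized x l k a b) {c : E} {u : Fin (n + 1) → E} {ψ : Fin n → E}
    (hl : ∀ i j, l i (k.succAbove j) =
      c * ((Pi.single (k.succAbove j) 1 - x (k.succAbove j) • Pi.single k 1 : Fin (n + 1) → E) i) +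
        ψ j * u i) (hc : c = 0 ∨ x ⬝ᵥ u = 0) {q : Fin n} (hq : ψ q = 1) :
    Algebra.trdeg ℂ E < (3 * n + 1 : ℕ) := by
  classical
  let g : Fin n ⊕ Fin n ⊕ Fin n ⊕ Unit → E :=
    Sum.elim (fun j => x (k.succAbove j)) (Sum.elim ψ (Sum.elim (fun j => u (k.succAbove j))
      fun _ => if c = 0 then u k else c))
  have hx : ∀ j, x (k.succAbove j) ∈ Algebra.adjoin ℂ (Set.range g) := fun j =>
    Algebra.subset_adjoin ⟨Sum.inl j, rfl⟩
  have hψ : ∀ j, ψ j ∈ Algebra.adjoin ℂ (Set.range g) := fun j =>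
    Algebra.subset_adjoin ⟨Sum.inr (Sum.inl j), rfl⟩
  have hu : ∀ j, u (k.succAbove j) ∈ Algebra.adjoin ℂ (Set.range g) := fun j =>
    Algebra.subset_adjoin ⟨Sum.inr (Sum.inr (Sum.inl j)), rfl⟩
  have hg : (if c = 0 then u k else c) ∈ Algebra.adjoin ℂ (Set.range g) :=
    Algebra.subset_adjoin ⟨Sum.inr (Sum.inr (Sum.inr ())), rfl⟩
  have hc' : c ∈ Algebra.adjoin ℂ (Set.range g) := by
    by_cases h0 : c = 0
    · rw [h0]
      exact zero_mem _
    · rwa [if_neg h0] at hg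
  have huk : u k ∈ Algebra.adjoin ℂ (Set.range g) := by
    by_cases h0 : c = 0
    · rwa [if_pos h0] at hg
    · have h1 := hc.resolve_left h0
      rw [dotProduct, Fin.sum_univ_succAbove _ k, h.apply_eq_one, one_mul] at h1
      rw [eq_neg_of_add_eq_zero_left h1]
      exact neg_mem (sum_mem fun i _ => mul_mem (hx i) (hu i))
  have hu' : ∀ i, u i ∈ Algebra.adjoin ℂ (Set.range g) := fun i => by
    rcases Fin.eq_self_or_eq_succAbove k i with rfl | ⟨i, rfl⟩
    · exact huk
    · exact hu i
  have hs : ∀ i j, (Pi.single i (1 : E) : Fin (n + 1) → E) j ∈ Algebra.adjoin ℂ (Set.range g) :=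
    fun i j => by
      rw [Pi.single_apply]
      split_ifs
      exacts [one_mem _, zero_mem _]
  have h1 := trdeg_lt_card h.adjoin_eq_top (g := g) (h.subset_adjoin hx (fun i j => by
      rw [hl]
      exact add_mem (mul_mem hc' (sub_mem (hs _ _) (mul_mem (hx j) (hs _ _))))
        (mul_mem (hψ j) (hu' i))))
    (not_algebraicIndependent_of_eq_one (q := Sum.inr (Sum.inl q)) hq)
  refine h1.trans_le (Nat.cast_le.2 ?_)
  simp
  omega

theorem IsNormalized.trdeg_lt_of_eq_add' {n : ℕ} (hn : n ≠ 0) {E : Type} [Field E] [Algebra ℂ E]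
    {x : Fin (n + 1) → E} {l : Matrix (Fin (n + 1)) (Fin (n + 1)) E} {k a b : Fin (n + 1)}
    (h : IsNormalized x l k a b) {c : E} {u : Fin (n + 1) → E} {ψ : Fin n → E}
    (hl : ∀ i j, l i (k.succAbove j) =
      c * ((Pi.single (k.succAbove j) 1 - x (k.succAbove j) • Pi.single k 1 : Fin (n + 1) → E) i) +
        ψ j * u i) (hc : c = 0 ∨ x ⬝ᵥ u = 0) :
    Algebra.trdeg ℂ E < (3 * n + 1 : ℕ) := by
  by_cases hψ : ∃ q, ψ q ≠ 0
  · obtain ⟨q, hq⟩ := hψ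
    refine h.trdeg_lt_of_eq_add (c := c) (u := ψ q • u) (ψ := fun j => ψ j / ψ q) (q := q)
      (fun i j => ?_) (hc.imp_right fun h0 => by rw [dotProduct_smul, h0, smul_zero])
      (div_self hq)
    rw [hl, Pi.smul_apply, smul_eq_mul, ← mul_assoc, div_mul_cancel₀ _ hq]
  · push Not at hψ
    refine h.trdeg_lt_of_eq_add (c := c) (u := 0) (ψ := fun _ => 1)
      (q := ⟨0, Nat.pos_of_ne_zero hn⟩)
      (fun i j => ?_) (Or.inr (dotProduct_zero _)) rfl
    rw [hl, hψ, Pi.zero_apply, zero_mul, mul_zero]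

theorem map_krylov {R R' : Type*} [CommRing R] [CommRing R'] (f : R →+* R') {n : ℕ} (x : Fin n → R)
    (l : Matrix (Fin n) (Fin n) R) : (krylov x l).map f = krylov (f ∘ x) (l.map f) := by
  ext i j
  simp only [krylov, Matrix.map_apply, Matrix.of_apply, ← Matrix.map_pow, RingHom.map_vecMul]

theorem exists_det_krylov_ne_zero {k a b : Fin 4} (hb : b ≠ k) :
    ∃ (x : Fin 4 → ℂ) (l : Matrix (Fin 4) (Fin 4) ℂ), x k = 1 ∧ (∀ i, l i k = 0) ∧ l a b = 1 ∧
      (krylov x l).det ≠ 0 := by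
  obtain ⟨s, hs, rfl, h3⟩ : ∃ s : Fin 4 → Fin 4, Function.Injective s ∧ s 0 = k ∧
      (a = k ∧ s 1 = b ∨ s 3 = a) := by
    have h4 : ∀ p q : Fin 4, p ≠ q → ∃ c d, c ≠ p ∧ c ≠ q ∧ d ≠ p ∧ d ≠ q ∧ c ≠ d := by decide
    have h5 : ∀ p q c d : Fin 4, p ≠ q → c ≠ p → c ≠ q → d ≠ p → d ≠ q → c ≠ d →
        Function.Injective ![p, q, c, d] := by
      intro p q c d h1 h2 h3 h4 h5 h6 i j hij
      fin_cases i <;> fin_cases j <;> simp_all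
    by_cases ha : a = k
    · obtain ⟨c, d, h1, h2, h3, h4, h6⟩ := h4 k b hb.symm
      exact ⟨![k, b, c, d], h5 _ _ _ _ hb.symm h1 h2 h3 h4 h6, rfl, Or.inl ⟨ha, rfl⟩⟩
    · obtain ⟨c, d, h1, h2, h3, h4, h6⟩ := h4 k a (Ne.symm ha)
      exact ⟨![k, c, d, a], h5 _ _ _ _ h1.symm h3 (Ne.symm h6) ha (Ne.symm h2) h4,
        rfl, Or.inr rfl⟩
  let σ := Equiv.ofBijective s hs.bijective_of_finite
  let l : Matrix (Fin 4) (Fin 4) ℂ := Matrix.of fun i =>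
    Pi.single (if i = s 3 then b else s (σ.symm i + 1)) 1
  have hl : ∀ i, l (s i) = Pi.single (if i = 3 then b else s (i + 1)) 1 := fun i => by
    have : σ.symm (s i) = i := σ.symm_apply_apply i
    change Pi.single (if s i = s 3 then b else s (σ.symm (s i) + 1)) 1 = _
    simp only [this, hs.eq_iff]
  have hl' : ∀ i, (Pi.single (s i) 1 : Fin 4 → ℂ) ᵥ* l =
      Pi.single (if i = 3 then b else s (i + 1)) 1 := fun i => by
    rw [← hl]
    exact Matrix.single_one_vecMul (s i) l
  refine ⟨Pi.single (s 0) 1, l, by simp, fun i => ?_, ?_, ?_⟩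
  · obtain ⟨i, rfl⟩ := σ.surjective i
    rw [show σ i = s i from rfl, hl, Pi.single_apply, if_neg]
    split_ifs with h
    · exact hb.symm
    · rw [hs.eq_iff]
      revert h
      revert i
      decide
  · rcases h3 with ⟨rfl, h1⟩ | rfl
    · rw [hl, if_neg (by decide), zero_add, h1, Pi.single_eq_same]
    · rw [hl, if_pos rfl, Pi.single_eq_same]
  · have : krylov (Pi.single (s 0) 1) l = (1 : Matrix (Fin 4) (Fin 4) ℂ).submatrix σ id := by
      have h1 := hl' 0
      have h2 := hl' 1
      have h3 := hl' 2
      rw [if_neg (by decide)] at h1 h2 h3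
      have e : ∀ i, krylov (Pi.single (s 0) 1) l i = Pi.single (s i) 1 := by
        intro i
        have : krylov (Pi.single (s 0) 1) l i = Pi.single (s 0) 1 ᵥ* l ^ (i : ℕ) := rfl
        rw [this]
        fin_cases i
        · simp
        · simpa using h1
        · simp [pow_two, ← Matrix.vecMul_vecMul, h1, h2]
        · simp [pow_succ, ← Matrix.vecMul_vecMul, h1, h2, h3]
      ext i j
      rw [e, Matrix.submatrix_apply, Matrix.one_apply, Pi.single_apply]
      simp [σ, eq_comm]
    rw [this, Matrix.det_permute]
    simp

theorem IsNormalized.trdeg_lt_of_det_krylov_eq_zero {E : Type} [Field E] [Algebra ℂ E]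
    {x : Fin 4 → E} {l : Matrix (Fin 4) (Fin 4) E} {k a b : Fin 4}
    (h : IsNormalized (n := 3) x l k a b) (h0 : (krylov x l).det = 0) :
    Algebra.trdeg ℂ E < (14 : ℕ) := by
  classical
  obtain ⟨q, hq⟩ := h.exists_succAbove_eq
  let τ := Fin 3 ⊕ {p : Fin 4 × Fin 3 // p ≠ (a, q)}
  have hτ : Fintype.card τ = 14 := by simp [τ]
  let X' : Fin 4 → MvPolynomial τ ℂ := k.insertNth 1 fun j => X (Sum.inl j)
  let L' : Matrix (Fin 4) (Fin 4) (MvPolynomial τ ℂ) := Matrix.of fun i =>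
    k.insertNth 0 fun j => if hp : (i, j) ≠ (a, q) then X (Sum.inr ⟨(i, j), hp⟩) else 1
  let z : ∀ {F : Type} [Field F], (Fin 4 → F) → Matrix (Fin 4) (Fin 4) F → τ → F := fun y m =>
    Sum.elim (fun j => y (k.succAbove j)) fun p => m p.1.1 (k.succAbove p.1.2)
  have hz : ∀ {F : Type} [Field F] [Algebra ℂ F] (y : Fin 4 → F) (m : Matrix (Fin 4) (Fin 4) F),
      y k = 1 → (∀ i, m i k = 0) → m a b = 1 →
      aeval (z y m) (krylov X' L').det = (krylov y m).det := by
    intro F _ _ y m hy hm hab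
    rw [AlgHom.map_det]
    congr 1
    refine (map_krylov _ X' L').trans ?_
    congr 1
    · funext i
      rcases Fin.eq_self_or_eq_succAbove k i with rfl | ⟨i, rfl⟩
      · simp [X', hy]
      · simp [X', z]
    · ext i j
      rcases Fin.eq_self_or_eq_succAbove k j with rfl | ⟨j, rfl⟩
      · simp [L', hm]
      · by_cases hp : (i, j) = (a, q)
        · obtain ⟨rfl, rfl⟩ := Prod.mk.inj hp
          simp only [L', Matrix.map_apply, Matrix.of_apply,
            Fin.insertNth_apply_succAbove]
          rw [dif_neg (not_not.2 rfl), hq, hab]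
          exact map_one _
        · simp only [L', Matrix.map_apply, Matrix.of_apply, Fin.insertNth_apply_succAbove]
          rw [dif_pos hp]
          simp [z]
  have hQ : (krylov X' L').det ≠ 0 := by
    intro h1
    obtain ⟨y, m, hy, hm, hab, h2⟩ := exists_det_krylov_ne_zero (k := k) (a := a) (b := b)
      (hq ▸ Fin.succAbove_ne _ _)
    rw [← hz y m hy hm hab, h1, map_zero] at h2
    exact h2 rfl
  rw [← hτ]
  refine trdeg_lt_card h.adjoin_eq_top (g := z x l) (h.subset_adjoin
    (fun j => Algebra.subset_adjoin ⟨Sum.inl j, rfl⟩) (fun i j => ?_)) (fun h1 => ?_)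
  · by_cases hp : (i, j) = (a, q)
    · obtain ⟨rfl, rfl⟩ := Prod.mk.inj hp
      rw [hq, h.entry_eq_one]
      exact one_mem _
    · exact Algebra.subset_adjoin ⟨Sum.inr ⟨(i, j), hp⟩, rfl⟩
  · have h2 := hz x l h.apply_eq_one h.col_eq_zero h.entry_eq_one
    rw [h0] at h2
    exact hQ ((injective_iff_map_eq_zero _).1 h1 _ h2)

end

theorem linearIndependent_fin_three_iff {E V : Type*} [Field E] [AddCommGroup V] [Module E V]
    {v u w : V} : LinearIndependent E ![v, u, w] ↔
      ∀ r s t : E, r • v + s • u + t • w = 0 → r = 0 ∧ s = 0 ∧ t = 0 := by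
  rw [Fintype.linearIndependent_iff]
  constructor
  · intro h r s t h0
    have := h ![r, s, t] (by simpa [Fin.sum_univ_three] using h0)
    exact ⟨this 0, this 1, this 2⟩
  · intro h g hg i
    have := h (g 0) (g 1) (g 2) (by simpa [Fin.sum_univ_three] using hg)
    fin_cases i
    exacts [this.1, this.2.1, this.2.2]

theorem linearIndependent_of_basis_action {E V : Type*} [Field E] [AddCommGroup V] [Module E V]
    {A : V →ₗ[E] V} {v u w : V} (h : LinearIndependent E ![v, u, w]) {c α β p₁ p₂ a b : E}
    (hv : A v = c • v + u) (hu : A u = c • u + α • v + β • u)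
    (hw : A w = c • w + p₁ • v + p₂ • u) (h1 : p₁ + b * α ≠ 0) (h2 : p₂ + a + b * β = 0) {y : V}
    (hy : y = w + a • v + b • u) : LinearIndependent E ![y, A y, A (A y)] := by
  rw [linearIndependent_fin_three_iff] at h ⊢
  have hAy : A y = c • y + (p₁ + b * α) • v := by
    obtain rfl : p₂ = - a - b * β := by linear_combination h2
    rw [hy]
    simp only [map_add, map_smul, hv, hu, hw]
    module
  have hAAy : A (A y) = (c * c) • y + (2 * c * (p₁ + b * α)) • v + (p₁ + b * α) • u := by
    rw [hAy, map_add, map_smul, map_smul, hAy, hv]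
    module
  intro r s t h0
  rw [hAAy, hAy, hy] at h0
  generalize p₁ + b * α = q at *
  obtain ⟨h3, h4, h5⟩ := h ((r + s * c + t * c * c) * a + s * q + t * 2 * c * q)
    ((r + s * c + t * c * c) * b + t * q) (r + s * c + t * c * c) (by
      rw [← h0]
      module)
  rw [h5, zero_mul, zero_add] at h4
  obtain rfl := (mul_eq_zero.1 h4).resolve_right h1
  have h6 : s * q = 0 := by linear_combination h3 - a * h5
  obtain rfl := (mul_eq_zero.1 h6).resolve_right h1
  exact ⟨by linear_combination h5, rfl, rfl⟩

/-- An endomorphism of a three-dimensional space without cyclic vector is the sum of a scalar and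
of an endomorphism of rank at most one. -/
theorem exists_eq_smul_add_smul {E V : Type*} [Field E] [AddCommGroup V] [Module E V]
    (hV : Module.finrank E V = 3) (A : V →ₗ[E] V)
    (h : ∀ v, ¬ LinearIndependent E ![v, A v, A (A v)]) :
    ∃ (c : E) (u : V) (ψ : V → E), ∀ y, A y = c • y + ψ y • u := by
  have : FiniteDimensional E V := Module.finite_of_finrank_pos (by omega)
  by_cases hA : ∀ v, ¬ LinearIndependent E ![v, A v]
  · obtain ⟨c, hc⟩ := LinearMap.exists_eq_smul_id_of_forall_notLinearIndependent hA
    exact ⟨c, 0, 0, fun y => by rw [hc]; simp⟩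
  push Not at hA
  obtain ⟨v, hvu⟩ := hA
  have hvu' := LinearIndependent.pair_iff.1 hvu
  obtain ⟨α₀, β₀, hαβ⟩ : ∃ α₀ β₀ : E, A (A v) = α₀ • v + β₀ • A v := by
    have := h v
    rw [linearIndependent_fin_three_iff] at this
    push Not at this
    obtain ⟨r, s, t, h0, h1⟩ := this
    have ht : t ≠ 0 := by
      rintro rfl
      rw [zero_smul, add_zero] at h0
      obtain ⟨hr, hs⟩ := hvu' r s h0
      exact h1 hr hs rfl
    refine ⟨-r / t, -s / t, ?_⟩
    have h2 : t • A (A v) = t • ((-r / t) • v + (-s / t) • A v) := by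
      rw [smul_add, smul_smul, smul_smul, mul_div_cancel₀ _ ht, mul_div_cancel₀ _ ht]
      rw [← sub_eq_zero, ← h0]
      module
    exact smul_right_injective V ht h2
  obtain ⟨w, hw⟩ : ∃ w, LinearIndependent E ![v, A v, w] := by
    obtain ⟨w, hw⟩ := exists_linearIndependent_snoc_of_lt_finrank hvu (by omega)
    have : (Fin.snoc ![v, A v] w : Fin 3 → V) = ![v, A v, w] := by
      ext i
      fin_cases i <;> rfl
    exact ⟨w, this ▸ hw⟩
  have hspan : ∀ y, ∃ r s t : E, y = r • v + s • A v + t • w := fun y => by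
    have h1 := hw.span_eq_top_of_card_eq_finrank' (by simp [hV])
    have h2 : y ∈ Submodule.span E (Set.range ![v, A v, w]) := h1 ▸ Submodule.mem_top
    obtain ⟨g, hg⟩ := (Submodule.mem_span_range_iff_exists_fun E).1 h2
    refine ⟨g 0, g 1, g 2, ?_⟩
    rw [← hg]
    simp [Fin.sum_univ_three]
  obtain ⟨p₁, p₂, c, hAw⟩ := hspan (A w)
  obtain ⟨u, hu⟩ : ∃ u, A v = c • v + u := ⟨A v - c • v, by abel⟩
  have hli : LinearIndependent E ![v, u, w] := by
    rw [linearIndependent_fin_three_iff] at hw ⊢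
    intro r s t h0
    obtain ⟨h1, rfl, rfl⟩ := hw (r - s * c) s t (by
      rw [← h0, hu]
      module)
    exact ⟨by linear_combination h1, rfl, rfl⟩
  obtain ⟨α, hα⟩ : ∃ α, α = α₀ + (β₀ - c) * c := ⟨_, rfl⟩
  have hAu : A u = c • u + α • v + (β₀ - 2 * c) • u := by
    have h1 : A u = A (A v) - c • A v := by
      rw [← map_smul, ← map_sub, hu, add_sub_cancel_left]
    rw [h1, hαβ, hu, hα]
    module
  have hAw' : A w = c • w + (p₁ + p₂ * c) • v + p₂ • u := by
    rw [hAw, hu]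
    module
  generalize p₁ + p₂ * c = q at hAw'
  generalize β₀ - 2 * c = β at hAu
  have key : ∀ b, q + b * α = 0 := fun b => by
    by_contra h1
    exact h _ (linearIndependent_of_basis_action hli hu hAu hAw' (a := -p₂ - b * β) h1
      (by ring) rfl)
  have hq : q = 0 := by simpa using key 0
  have hα0 : α = 0 := by simpa [hq] using key 1
  choose f g t hfg using hspan
  refine ⟨c, u, fun y => f y + g y * c + g y * β + t y * p₂, fun y => ?_⟩
  rw [hq] at hAw'
  rw [hα0] at hAu
  have e := hfg y
  beta_reduce
  generalize f y = f' at *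
  generalize g y = g' at *
  generalize t y = t' at *
  rw [e, hu]
  simp only [map_add, map_smul, hu, hAu, hAw']
  module

section

open scoped Matrix

theorem le_choose_of_five_le {n k : ℕ} (hn : 3 ≤ n) (hk : 3 ≤ k) (h : 5 ≤ n ∨ 4 ≤ k) :
    n + (n + 1) * n ≤ (n + k - 1).choose k := by
  obtain ⟨m, rfl⟩ : ∃ m, n = m + 1 := ⟨n - 1, by omega⟩
  rw [show m + 1 + k - 1 = m + k by omega, ← Nat.choose_symm_add]
  by_cases hk4 : 4 ≤ k
  · refine le_trans ?_ (Nat.choose_le_choose m (show m + 4 ≤ m + k by omega))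
    rw [Nat.choose_symm_add]
    obtain ⟨p, rfl⟩ : ∃ p, m = p + 2 := ⟨m - 2, by omega⟩
    have h1 := Nat.descFactorial_eq_factorial_mul_choose (p + 2 + 4) 4
    simp only [Nat.descFactorial, Nat.factorial] at h1
    rw [show p + 2 + 4 - 3 = p + 3 by omega, show p + 2 + 4 - 2 = p + 4 by omega,
      show p + 2 + 4 - 1 = p + 5 by omega] at h1
    generalize (p + 2 + 4).choose 4 = c at *
    norm_num at h1
    nlinarith [sq_nonneg p, Nat.zero_le (p ^ 3), Nat.zero_le (p ^ 4)]
  · refine le_trans ?_ (Nat.choose_le_choose m (show m + 3 ≤ m + k by omega))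
    rw [Nat.choose_symm_add]
    obtain ⟨p, rfl⟩ : ∃ p, m = p + 4 := ⟨m - 4, by omega⟩
    have h1 := Nat.descFactorial_eq_factorial_mul_choose (p + 4 + 3) 3
    simp only [Nat.descFactorial, Nat.factorial] at h1
    rw [show p + 4 + 3 - 2 = p + 5 by omega, show p + 4 + 3 - 1 = p + 6 by omega] at h1
    generalize (p + 4 + 3).choose 3 = c at *
    norm_num at h1
    nlinarith [sq_nonneg p, Nat.zero_le (p ^ 3)]

theorem finrank_perp_singleton {E : Type*} [Field E] {n : ℕ} {x : Fin (n + 1) → E} (hx : x ≠ 0) :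
    Module.finrank E (perp ![x]) = n := by
  obtain ⟨j, hj⟩ := Function.ne_iff.1 hx
  have h1 := le_finrank_perp ![x]
  have h2 := Submodule.finrank_lt (s := perp ![x]) fun h => hj (by
    have h3 : Pi.single j 1 ∈ perp ![x] := h ▸ Submodule.mem_top
    simpa using mem_perp.1 h3 0)
  rw [Module.finrank_fin_fun] at h2
  omega

/-- The vector `e_j - x_j e_k`, which is orthogonal to `x` when `x_k = 1`. -/
def perpVec {E : Type*} [Field E] {n : ℕ} (x : Fin n → E) (k j : Fin n) : Fin n → E :=
  Pi.single j 1 - x j • Pi.single k 1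

theorem dotProduct_perpVec {E : Type*} [Field E] {n : ℕ} (x y : Fin n → E) (k j : Fin n) :
    y ⬝ᵥ perpVec x k j = y j - x j * y k := by
  rw [perpVec, dotProduct_sub, dotProduct_smul, dotProduct_single_one, dotProduct_single_one,
    smul_eq_mul]

theorem IsNormalized.dotProduct_perpVec_eq_zero {n : ℕ} {E : Type} [Field E] [Algebra ℂ E]
    {x : Fin (n + 1) → E} {l : Matrix (Fin (n + 1)) (Fin (n + 1)) E} {k a b : Fin (n + 1)}
    (h : IsNormalized x l k a b) (j : Fin (n + 1)) : x ⬝ᵥ perpVec x k j = 0 := by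
  rw [dotProduct_perpVec, h.apply_eq_one, mul_one, sub_self]

theorem IsNormalized.perpVec_mem {n : ℕ} {E : Type} [Field E] [Algebra ℂ E]
    {x : Fin (n + 1) → E} {l : Matrix (Fin (n + 1)) (Fin (n + 1)) E} {k a b : Fin (n + 1)}
    (h : IsNormalized x l k a b) (j : Fin (n + 1)) : perpVec x k j ∈ perp ![x] :=
  mem_perp.2 fun i => by
    rw [Subsingleton.elim i 0]
    exact h.dotProduct_perpVec_eq_zero j

theorem IsNormalized.mulVec_perpVec {n : ℕ} {E : Type} [Field E] [Algebra ℂ E]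
    {x : Fin (n + 1) → E} {l : Matrix (Fin (n + 1)) (Fin (n + 1)) E} {k a b : Fin (n + 1)}
    (h : IsNormalized x l k a b) (i j : Fin (n + 1)) : (l *ᵥ perpVec x k j) i = l i j := by
  rw [Matrix.mulVec, dotProduct_perpVec, h.col_eq_zero, mul_zero, sub_zero]

theorem IsNormalized.hasRank_choose {n k' : ℕ} {E : Type} [Field E] [Algebra ℂ E] [CharZero E]
    {x : Fin (n + 1) → E} {l : Matrix (Fin (n + 1)) (Fin (n + 1)) E} {k a b : Fin (n + 1)}
    (h : IsNormalized x l k a b) : HasRank x l (k' + 1) ((n + k' - 1).choose k') :=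
  hasRank_of_mulVec_ne_zero ⟨perpVec x k b, h.perpVec_mem b, fun h0 => by
    have := h.mulVec_perpVec a b
    rw [h0, h.entry_eq_one] at this
    exact zero_ne_one this⟩

theorem IsNormalized.hasRank_or_trdeg_lt {E : Type} [Field E] [Algebra ℂ E] [CharZero E]
    {x : Fin 4 → E} {l : Matrix (Fin 4) (Fin 4) E} {k a b : Fin 4}
    (h : IsNormalized (n := 3) x l k a b) (h0 : x ᵥ* l = 0) :
    HasRank x l 4 12 ∨ Algebra.trdeg ℂ E < (10 : ℕ) := by
  have hx0 : x ≠ 0 := fun h1 => by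
    have := h.apply_eq_one
    rw [h1] at this
    exact zero_ne_one this
  have hinv : ∀ y ∈ perp ![x], l.mulVecLin y ∈ perp ![x] := fun y _ => mem_perp.2 fun i => by
    rw [Subsingleton.elim i 0, Matrix.mulVecLin_apply, Matrix.dotProduct_mulVec]
    change (x ᵥ* l) ⬝ᵥ y = 0
    rw [h0, zero_dotProduct]
  let A := l.mulVecLin.restrict hinv
  by_cases hc : ∀ v, ¬ LinearIndependent E ![v, A v, A (A v)]
  · right
    obtain ⟨c, u, ψ, hA⟩ := exists_eq_smul_add_smul (finrank_perp_singleton (n := 3) hx0) A hc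
    refine h.trdeg_lt_of_eq_add' (n := 3) (by norm_num) (c := c) (u := u)
      (ψ := fun j => ψ ⟨_, h.perpVec_mem (k.succAbove j)⟩) (fun i j => ?_)
      (Or.inr (mem_perp.1 u.2 0))
    rw [← h.mulVec_perpVec]
    exact congrFun (congrArg Subtype.val (hA ⟨_, h.perpVec_mem (k.succAbove j)⟩)) i
  · left
    push Not at hc
    obtain ⟨v, hv⟩ := hc
    have h1 := hv.map' (perp ![x]).subtype (Submodule.ker_subtype _)
    refine hasRank_of_cyclic (v := v) (u := A v) (w := A (A v)) rfl rfl v.2 (A v).2 (A (A v)).2 ?_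
    have h2 : ![(v : Fin 4 → E), A v, A (A v)] = (perp ![x]).subtype ∘ ![v, A v, A (A v)] := by
      ext i
      fin_cases i <;> rfl
    rw [h2]
    exact h1

theorem IsNormalized.exists_ne_zero_or_trdeg_lt {n : ℕ} (hn : n ≠ 0) {E : Type} [Field E]
    [Algebra ℂ E] {x : Fin (n + 1) → E} {l : Matrix (Fin (n + 1)) (Fin (n + 1)) E}
    {k a b : Fin (n + 1)} (h : IsNormalized x l k a b) (h0 : x ᵥ* l ≠ 0) :
    ((∃ y, x ⬝ᵥ y = 0 ∧ (x ᵥ* l) ⬝ᵥ y ≠ 0) ∧ ∃ v ∈ perp ![x, x ᵥ* l], l *ᵥ v ≠ 0) ∨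
      Algebra.trdeg ℂ E < (3 * n + 1 : ℕ) := by
  obtain ⟨q, hq⟩ := Function.ne_iff.1 h0
  generalize hφ : x ᵥ* l = φ at *
  rw [Pi.zero_apply] at hq
  have hφk : φ k = 0 := by
    rw [← hφ, Matrix.vecMul, dotProduct]
    exact Finset.sum_eq_zero fun i _ => by rw [h.col_eq_zero, mul_zero]
  have hφj : ∀ j, φ ⬝ᵥ perpVec x k j = φ j := fun j => by
    rw [dotProduct_perpVec, hφk, mul_zero, sub_zero]
  by_cases hK : ∃ v ∈ perp ![x, φ], l *ᵥ v ≠ 0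
  · exact Or.inl ⟨⟨perpVec x k q, h.dotProduct_perpVec_eq_zero q, by rwa [hφj]⟩, hK⟩
  · push Not at hK
    refine Or.inr (h.trdeg_lt_of_eq_add' hn (c := 0) (u := fun i => l i q)
      (ψ := fun j => φ (k.succAbove j) / φ q) (fun i j => ?_) (Or.inl rfl))
    have h1 := hK (perpVec x k (k.succAbove j) - (φ (k.succAbove j) / φ q) • perpVec x k q) (by
      refine mem_perp.2 (Fin.forall_fin_two.2 ⟨?_, ?_⟩)
      · change x ⬝ᵥ _ = 0
        rw [dotProduct_sub, dotProduct_smul, h.dotProduct_perpVec_eq_zero,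
          h.dotProduct_perpVec_eq_zero, smul_zero, sub_zero]
      · change φ ⬝ᵥ _ = 0
        rw [dotProduct_sub, dotProduct_smul, hφj, hφj, smul_eq_mul, div_mul_cancel₀ _ hq, sub_self])
    have h2 := congrFun h1 i
    rw [Matrix.mulVec_sub, Matrix.mulVec_smul, Pi.sub_apply, Pi.smul_apply, h.mulVec_perpVec,
      h.mulVec_perpVec, Pi.zero_apply, sub_eq_zero, smul_eq_mul] at h2
    rw [h2, zero_mul, zero_add]

theorem IsNormalized.exists_hasRank_three {E : Type} [Field E] [Algebra ℂ E] [CharZero E]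
    {x : Fin 4 → E} {l : Matrix (Fin 4) (Fin 4) E} {k a b : Fin 4}
    (h : IsNormalized (n := 3) x l k a b) :
    ∃ r : ℕ, HasRank x l 4 r ∧ Algebra.trdeg ℂ E < r := by
  by_cases h0 : x ᵥ* l = 0
  · rcases h.hasRank_or_trdeg_lt h0 with h1 | h1
    · exact ⟨_, h1, h.trdeg_lt_of_vecMul_eq_zero h0⟩
    · exact ⟨_, h.hasRank_choose (k' := 3), h1⟩
  · rcases h.exists_ne_zero_or_trdeg_lt (by norm_num) h0 with ⟨h1, h2⟩ | h1
    · by_cases h3 : (krylov x l).det = 0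
      · exact ⟨_, hasRank_of_mulVec_ne_zero_of_dotProduct_ne_zero (n := 2) (k := 3) h1 h2,
          h.trdeg_lt_of_det_krylov_eq_zero h3⟩
      · exact ⟨_, hasRank_of_det_krylov_ne_zero (n := 3) (k := 3) h3, h.trdeg_lt⟩
    · exact ⟨_, h.hasRank_choose (k' := 3), h1⟩

theorem IsNormalized.exists_hasRank_four {E : Type} [Field E] [Algebra ℂ E] [CharZero E]
    {x : Fin 5 → E} {l : Matrix (Fin 5) (Fin 5) E} {k a b : Fin 5}
    (h : IsNormalized (n := 4) x l k a b) :
    ∃ r : ℕ, HasRank x l 4 r ∧ Algebra.trdeg ℂ E < r := by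
  by_cases h0 : x ᵥ* l = 0
  · exact ⟨_, h.hasRank_choose (k' := 3), h.trdeg_lt_of_vecMul_eq_zero h0⟩
  · rcases h.exists_ne_zero_or_trdeg_lt (by norm_num) h0 with ⟨h1, h2⟩ | h1
    · refine ⟨_, hasRank_of_mulVec_ne_zero_of_dotProduct_ne_zero (n := 3) (k := 3) h1 h2,
        h.trdeg_lt.trans_le (Nat.cast_le.2 ?_)⟩
      decide
    · refine ⟨_, h.hasRank_choose (k' := 3), h1.trans_le (Nat.cast_le.2 ?_)⟩
      decide

/-- There is a space of forms killed by the derivative along `x`, on which the derivation given by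
`l` is injective, of dimension larger than the transcendence degree of the field generated by `x`
and `l`. -/
theorem IsNormalized.exists_hasRank {n d : ℕ} (hd : 4 ≤ d) (hn : 3 ≤ n) {E : Type} [Field E]
    [Algebra ℂ E] {x : Fin (n + 1) → E} {l : Matrix (Fin (n + 1)) (Fin (n + 1)) E}
    {k a b : Fin (n + 1)} (h : IsNormalized x l k a b) :
    ∃ r : ℕ, HasRank x l d r ∧ Algebra.trdeg ℂ E < r := by
  have : CharZero E := charZero_of_injective_algebraMap (algebraMap ℂ E).injective
  obtain ⟨k', rfl⟩ : ∃ k', d = k' + 1 := ⟨d - 1, by omega⟩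
  by_cases hnk : 5 ≤ n ∨ 4 ≤ k'
  · exact ⟨_, h.hasRank_choose,
      h.trdeg_lt.trans_le (Nat.cast_le.2 (le_choose_of_five_le hn (by omega) hnk))⟩
  · obtain rfl : k' = 3 := by omega
    rcases (show n = 3 ∨ n = 4 by omega) with rfl | rfl
    · exact h.exists_hasRank_three
    · exact h.exists_hasRank_four

end

theorem adjoin_preimage_eq_top {K : Type} [Field K] [Algebra ℂ K] (s : Set K) :
    IntermediateField.adjoin ℂ ((↑) ⁻¹' s : Set (IntermediateField.adjoin ℂ s)) = ⊤ := by
  apply IntermediateField.map_injective (IntermediateField.adjoin ℂ s).val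
  rw [IntermediateField.adjoin_map, ← AlgHom.fieldRange_eq_map, IntermediateField.fieldRange_val]
  congr 1
  exact Subtype.image_preimage_val _ _ |>.trans
    (Set.inter_eq_right.2 (IntermediateField.subset_adjoin ℂ s))

theorem not_syzygy_of_normalized {n d : ℕ} (hd : 4 ≤ d) (hn : 3 ≤ n) {K : Type} [Field K]
    [Algebra ℂ K] {c : Mon (n + 1) d → K} (hc : AlgebraicIndependent ℂ c) {x : Fin (n + 1) → K}
    {l : Matrix (Fin (n + 1)) (Fin (n + 1)) K} {p : MvPolynomial (Fin (n + 1)) K}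
    {k a b : Fin (n + 1)} (hxk : x k = 1) (hlk : ∀ i, l i k = 0) (hab : l a b = 1)
    (hrow : a ≠ k ∨ ∀ i, i ≠ k → ∀ j, l i j = 0) :
    lin x * p ≠ ∑ i, lin (l i) * pderiv i (formOf c) := by
  intro h
  let s : Set K := Set.range x ∪ Set.range fun q : Fin (n + 1) × Fin (n + 1) => l q.1 q.2
  let E := IntermediateField.adjoin ℂ s
  let xE : Fin (n + 1) → E := fun j =>
    ⟨x j, IntermediateField.subset_adjoin ℂ s (Or.inl ⟨j, rfl⟩)⟩
  let lE : Matrix (Fin (n + 1)) (Fin (n + 1)) E := fun i j =>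
    ⟨l i j, IntermediateField.subset_adjoin ℂ s (Or.inr ⟨(i, j), rfl⟩)⟩
  have hN : IsNormalized xE lE k a b := by
    refine ⟨Subtype.ext hxk, fun i => Subtype.ext ?_, Subtype.ext ?_, ?_, ?_⟩
    · simp [lE, hlk]
    · simp [lE, hab]
    · refine hrow.imp_right fun hr i hi j => Subtype.ext ?_
      simp [lE, hr i hi]
    · rw [← adjoin_preimage_eq_top s]
      congr 1
      ext z
      simp only [s, xE, lE, Set.mem_union, Set.mem_range, Set.mem_preimage, Subtype.ext_iff]
  obtain ⟨r, hr, hlt⟩ := hN.exists_hasRank hd hn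
  have := hr.le_trdeg (K := K) (by omega) hc (x' := x) (l' := l) (fun _ => rfl) (fun _ _ => rfl) h
  exact absurd this (not_le.2 hlt)

theorem mul_eq_mul_of_syzygy {n d : ℕ} (hd : 4 ≤ d) (hn : 3 ≤ n) {K : Type} [Field K]
    [Algebra ℂ K] {c : Mon (n + 1) d → K} (hc : AlgebraicIndependent ℂ c) {x : Fin (n + 1) → K}
    {l : Matrix (Fin (n + 1)) (Fin (n + 1)) K} {p : MvPolynomial (Fin (n + 1)) K}
    (h : lin x * p = ∑ i, lin (l i) * pderiv i (formOf c)) (i j k : Fin (n + 1)) :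
    l i j * x k = l i k * x j := by
  by_cases hx : x = 0
  · simp [hx]
  obtain ⟨q, hq⟩ : ∃ q, x q ≠ 0 := Function.ne_iff.1 hx
  let y : Fin (n + 1) → K := (x q)⁻¹ • x
  let m : Matrix (Fin (n + 1)) (Fin (n + 1)) K := fun i => l i - l i q • y
  have hyq : y q = 1 := by simp [y, hq]
  by_cases hm : m = 0
  · have h1 : ∀ i j, l i j = l i q * y j := fun i j => by
      have := congrFun (congrFun hm i) j
      simpa [m, sub_eq_zero] using this
    rw [h1 i j, h1 i k]
    simp only [y, Pi.smul_apply, smul_eq_mul]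
    ring
  exfalso
  obtain ⟨a, b, hab, hrow⟩ : ∃ a b, m a b ≠ 0 ∧ (a ≠ q ∨ ∀ i, i ≠ q → ∀ j, m i j = 0) := by
    by_cases hz : ∀ i, i ≠ q → ∀ j, m i j = 0
    · obtain ⟨a, ha⟩ := Function.ne_iff.1 hm
      obtain ⟨b, hb⟩ := Function.ne_iff.1 ha
      exact ⟨a, b, hb, Or.inr hz⟩
    · push Not at hz
      obtain ⟨a, ha, b, hb⟩ := hz
      exact ⟨a, b, hb, Or.inl ha⟩
  let m' : Matrix (Fin (n + 1)) (Fin (n + 1)) K := fun i => (m a b)⁻¹ • m i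
  have key : lin y * (C (m a b)⁻¹ * (C (x q) * p - ∑ i, C (l i q) * pderiv i (formOf c))) =
      ∑ i, lin (m' i) * pderiv i (formOf c) := by
    have h1 : lin y * C (x q) = lin x := by
      rw [mul_comm, ← lin_smul]
      simp [y, smul_smul, hq]
    have h2 : ∀ i, lin (m' i) = C (m a b)⁻¹ * (lin (l i) - C (l i q) * lin y) := fun i => by
      rw [← lin_smul, ← lin_sub, ← lin_smul]
    have h3 : ∀ g : Fin (n + 1) → MvPolynomial (Fin (n + 1)) K, ∑ i, lin (m' i) * g i =
        C (m a b)⁻¹ * (∑ i, lin (l i) * g i - lin y * ∑ i, C (l i q) * g i) := by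
      intro g
      rw [Finset.mul_sum, ← Finset.sum_sub_distrib, Finset.mul_sum]
      refine Finset.sum_congr rfl fun i _ => ?_
      rw [h2]
      ring
    rw [h3, ← h, ← h1]
    ring
  refine not_syzygy_of_normalized hd hn (a := a) (b := b) hc hyq ?_ ?_ ?_ key
  · intro i
    simp [m', m, hyq]
  · simp [m', hab]
  · refine hrow.imp_right fun hr i hi j => ?_
    simp [m', hr i hi]

/-- A form of degree `d` in the Jacobian ideal of a form of degree `d` is a combination of the
partial derivatives with linear coefficients. -/
theorem exists_linear_coeff_of_mem_jacobianIdeal {n d : ℕ} (hd : 1 ≤ d) {f q : S n}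
    (hf : f.IsHomogeneous d) (hq : q.IsHomogeneous d) (h : q ∈ jacobianIdeal f) :
    ∃ l : Matrix (Fin (n + 1)) (Fin (n + 1)) ℂ, q = ∑ i, lin (l i) * pderiv i f := by
  obtain ⟨a, ha⟩ := (Submodule.mem_span_range_iff_exists_fun (S n)).1 h
  refine ⟨fun i j => coeff (Finsupp.single j 1) (homogeneousComponent 1 (a i)), ?_⟩
  have h1 : ∀ i, lin (fun j => coeff (Finsupp.single j 1) (homogeneousComponent 1 (a i))) =
      homogeneousComponent 1 (a i) := fun i =>
    lin_coeff (homogeneousComponent_isHomogeneous 1 (a i))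
  simp only [h1]
  have h2 : ∀ i, homogeneousComponent d (a i * pderiv i f) =
      homogeneousComponent 1 (a i) * pderiv i f := by
    intro i
    conv_lhs => rw [← sum_homogeneousComponent (a i), Finset.sum_mul, map_sum]
    have h3 : ∀ k, homogeneousComponent d (homogeneousComponent k (a i) * pderiv i f) =
        if k = 1 then homogeneousComponent 1 (a i) * pderiv i f else 0 := by
      intro k
      rw [homogeneousComponent_of_mem (n := k + (d - 1))
        ((homogeneousComponent_isHomogeneous k (a i)).mul hf.pderiv)]
      by_cases hk : k = 1
      · subst hk
        rw [if_pos (by omega), if_pos rfl]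
      · rw [if_neg (by omega), if_neg hk]
    simp only [h3, Finset.sum_ite_eq', Finset.mem_range]
    split_ifs with h4
    · rfl
    · rw [homogeneousComponent_eq_zero _ _ (by omega), zero_mul]
  rw [← homogeneousComponent_eq_self hq, ← ha, map_sum]
  exact Finset.sum_congr rfl fun i _ => h2 i

theorem isPolyFun_eval {M σ : Type} [AddCommGroup M] [Module ℂ M] (L : σ → M →ₗ[ℂ] ℂ)
    (φ : MvPolynomial σ ℂ) : IsPolyFun (fun f : M => eval (fun i => L i f) φ) := by
  unfold IsPolyFun
  have : (fun f : M => eval (fun i => L i f) φ) = aeval (fun i => (⇑(L i) : M → ℂ)) φ := by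
    funext f
    have : (Pi.evalAlgHom ℂ (fun _ : M => ℂ) f).comp (aeval (fun i => (⇑(L i) : M → ℂ))) =
        aeval (fun i => L i f) := by
      ext; simp
    rw [← coe_aeval_eq_eval, ← this]; rfl
  rw [this]
  refine Algebra.adjoin_mono (s := Set.range fun i => (⇑(L i) : M → ℂ)) ?_ ?_
  · rintro _ ⟨i, rfl⟩
    exact ⟨L i, rfl⟩
  · rw [Algebra.adjoin_range_eq_range_aeval]
    exact ⟨φ, rfl⟩

theorem genericallyHolds_of_coeff {n d : ℕ} {Φ : MvPolynomial (Mon n d) ℂ} (hΦ : Φ ≠ 0)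
    {P : homogeneousSubmodule (Fin n) ℂ d → Prop}
    (h : ∀ f : homogeneousSubmodule (Fin n) ℂ d,
      eval (fun m : Mon n d => coeff m.1 (f : MvPolynomial (Fin n) ℂ)) Φ ≠ 0 → P f) :
    GenericallyHolds P := by
  let L : Mon n d → homogeneousSubmodule (Fin n) ℂ d →ₗ[ℂ] ℂ := fun m =>
    (lcoeff ℂ m.1).comp (Submodule.subtype _)
  refine ⟨fun f => eval (fun m => L m f) Φ, isPolyFun_eval L _, ?_, h⟩
  obtain ⟨z, hz⟩ : ∃ z, eval z Φ ≠ 0 := by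
    by_contra! hcon
    exact hΦ (MvPolynomial.funext (by simpa using hcon))
  refine ⟨⟨formOf z, isHomogeneous_formOf z⟩, ?_⟩
  have hLz : (fun m => coeff m.1 (formOf z)) = z := _root_.funext fun m => coeff_formOf z m
  change eval (fun m => coeff m.1 (formOf z)) Φ ≠ 0
  rwa [hLz]

/-- For `d ≥ 4`, `n ≥ 3` and generic `f ∈ S^d`: for every nonzero linear form `x`,
multiplication by `x` is injective from `R_f^{d-1}` to `R_f^d`. -/
theorem mult_by_any_linear_form_injective (n d : ℕ) (hd : 4 ≤ d) (hn : 3 ≤ n) :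
    GenericallyHolds (fun f : MvPolynomial.homogeneousSubmodule (Fin (n + 1)) ℂ d =>
      ∀ x : S n, x.IsHomogeneous 1 → x ≠ 0 →
        ∀ p : S n, p.IsHomogeneous (d - 1) →
          x * p ∈ jacobianIdeal (f : S n) → p ∈ jacobianIdeal (f : S n)) := by
  let σ := Mon (n + 1) d
  let τ := Fin (n + 1) ⊕ (Fin (n + 1) × Fin (n + 1)) ⊕ Mon (n + 1) (d - 1)
  let c : σ → MvPolynomial (σ ⊕ τ) ℂ := fun m => X (Sum.inl m)
  let xx : Fin (n + 1) → MvPolynomial (σ ⊕ τ) ℂ := fun j => X (Sum.inr (Sum.inl j))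
  let ll : Matrix (Fin (n + 1)) (Fin (n + 1)) (MvPolynomial (σ ⊕ τ) ℂ) :=
    fun i j => X (Sum.inr (Sum.inr (Sum.inl (i, j))))
  let pp : Mon (n + 1) (d - 1) → MvPolynomial (σ ⊕ τ) ℂ :=
    fun m => X (Sum.inr (Sum.inr (Sum.inr m)))
  let eqn : MvPolynomial (Fin (n + 1)) (MvPolynomial (σ ⊕ τ) ℂ) :=
    lin xx * formOf pp - ∑ i, lin (ll i) * pderiv i (formOf c)
  let I : Set (MvPolynomial (σ ⊕ τ) ℂ) := Set.range fun m => coeff m eqn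
  let g : Fin (n + 1) × Fin (n + 1) × Fin (n + 1) → MvPolynomial (σ ⊕ τ) ℂ :=
    fun q => ll q.1 q.2.1 * xx q.2.2 - ll q.1 q.2.2 * xx q.2.1
  have hmap : ∀ {K : Type} [Field K] (ψ : MvPolynomial (σ ⊕ τ) ℂ →+* K),
      map ψ eqn = lin (fun j => ψ (xx j)) * formOf (fun m => ψ (pp m)) -
        ∑ i, lin (fun j => ψ (ll i j)) * pderiv i (formOf fun m => ψ (c m)) := by
    intro K _ ψ
    simp only [eqn, map_sub, map_mul, map_sum, map_lin, map_formOf, ← pderiv_map]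
  have hI : ∀ {K : Type} [Field K] (ψ : MvPolynomial (σ ⊕ τ) ℂ →+* K),
      (∀ p ∈ I, ψ p = 0) ↔ map ψ eqn = 0 := by
    intro K _ ψ
    simp only [I, Set.forall_mem_range, MvPolynomial.ext_iff, coeff_map, coeff_zero]
  have hgen : ∀ q, ∃ φ : MvPolynomial σ ℂ, φ ≠ 0 ∧ ∀ z : σ ⊕ τ → ℂ,
      eval (fun i => z (Sum.inl i)) φ ≠ 0 → (∀ p ∈ I, eval z p = 0) → eval z (g q) = 0 := by
    intro q
    refine exists_ne_zero_forall_eval_eq_zero I (g q) fun K _ _ z hz hzI => ?_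
    have h1 := (hI (aeval z : MvPolynomial (σ ⊕ τ) ℂ →ₐ[ℂ] K).toRingHom).1 hzI
    rw [hmap, sub_eq_zero] at h1
    have h2 := mul_eq_mul_of_syzygy hd hn
      (c := fun m => (aeval z : MvPolynomial (σ ⊕ τ) ℂ →ₐ[ℂ] K).toRingHom (c m))
      (by simpa [c] using hz) h1 q.1 q.2.1 q.2.2
    simpa [g, sub_eq_zero] using h2
  choose φ hφ hφI using hgen
  refine genericallyHolds_of_coeff (Φ := ∏ q, φ q)
    (Finset.prod_ne_zero_iff.2 fun q _ => hφ q) fun f hf => ?_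
  intro x hx hx0 p hp hxp
  obtain ⟨f, hfd⟩ := f
  change f.IsHomogeneous d at hfd
  dsimp only at hxp ⊢
  obtain ⟨l, hl⟩ := exists_linear_coeff_of_mem_jacobianIdeal (by omega) hfd
    (by simpa [show 1 + (d - 1) = d by omega] using hx.mul hp) hxp
  let z : σ ⊕ τ → ℂ := Sum.elim (fun m => coeff m.1 f)
    (Sum.elim (fun j => coeff (Finsupp.single j 1) x)
      (Sum.elim (fun q => l q.1 q.2) (fun m => coeff m.1 p)))
  have hzI : ∀ q ∈ I, eval z q = 0 := by
    rw [hI, hmap]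
    simp only [c, xx, ll, pp, eval_X, z, Sum.elim_inl, Sum.elim_inr]
    rw [lin_coeff hx, formOf_coeff hp, formOf_coeff hfd, hl, sub_self]
  have hmin : ∀ i j k, l i j * coeff (Finsupp.single k 1) x =
      l i k * coeff (Finsupp.single j 1) x := by
    intro i j k
    have h1 : eval (fun m => z (Sum.inl m)) (φ (i, j, k)) ≠ 0 := by
      intro h0
      apply hf
      rw [map_prod]
      exact Finset.prod_eq_zero (Finset.mem_univ (i, j, k)) h0
    have h2 := hφI (i, j, k) z h1 hzI
    simpa [g, sub_eq_zero, ll, xx, z] using h2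
  obtain ⟨k, hk⟩ : ∃ k, coeff (Finsupp.single k 1) x ≠ 0 := by
    by_contra! hcon
    apply hx0
    rw [← lin_coeff hx]
    simp [lin, hcon]
  have hli : ∀ i, lin (l i) = C (l i k / coeff (Finsupp.single k 1) x) * x := by
    intro i
    have h1 : ∀ j, l i j =
        l i k / coeff (Finsupp.single k 1) x * coeff (Finsupp.single j 1) x := fun j => by
      field_simp
      exact hmin i j k
    have h2 := lin_coeff hx
    generalize l i k / coeff (Finsupp.single k 1) x = r at h1
    conv_rhs => rw [← h2]
    simp only [lin, Finset.mul_sum, ← mul_assoc, ← C_mul, ← h1]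
  have hpe : p = ∑ i, C (l i k / coeff (Finsupp.single k 1) x) * pderiv i f := by
    apply mul_left_cancel₀ hx0
    rw [hl, Finset.mul_sum]
    refine Finset.sum_congr rfl fun i _ => ?_
    rw [hli]; ring
  rw [hpe]
  exact Ideal.sum_mem _ fun i _ => Ideal.mul_mem_left _ _ (Ideal.subset_span ⟨i, rfl⟩)

end
end

section
/- Let d ≥ 4 and n ≥ 5. For generic f ∈ S^d, the following holds: if x, y ∈ S^1 are nonzero linear forms with x·R_f^{d-1} = y·R_f^{d-1} as subspaces of R_f^d, then x and y are proportional. Consequently the map Φ : P(S^1) → Grassmannian of (dim R_f^{d-1})-dimensional subspaces of R_f^d, x ↦ x·R_f^{d-1}, is injective. -/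
open MvPolynomial

noncomputable section

lemma isHomogeneous_one_iff_exists_sum {σ R : Type*} [Fintype σ] [CommSemiring R]
    {x : MvPolynomial σ R} :
    x.IsHomogeneous 1 ↔ ∃ a : σ → R, ∑ i, a i • MvPolynomial.X i = x := by
  rw [← mem_homogeneousSubmodule, homogeneousSubmodule_one_eq_span_X,
    Submodule.mem_span_range_iff_exists_fun]

lemma homogeneousComponent_mul_of_right {σ R : Type*} [CommSemiring R]
    {q : MvPolynomial σ R} {j : ℕ} (hq : q.IsHomogeneous j) (p : MvPolynomial σ R) (i : ℕ) :
    homogeneousComponent (i + j) (p * q) = homogeneousComponent i p * q := by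
  let := MvPolynomial.gradedAlgebra (σ := σ) (R := R)
  rw [← decomposition.decompose'_apply, ← decomposition.decompose'_apply]
  exact DirectSum.coe_decompose_mul_add_of_right_mem (homogeneousSubmodule σ R)
    ((mem_homogeneousSubmodule j q).2 hq)

/-- If multiplication by a nonzero linear form sends all forms of degree `k` into an ideal
generated by forms of degree `k`, then the number of monomials of degree `k` is bounded by the
number of products of a variable and a generator. -/
lemma multichoose_le_of_mul_mem_span {σ ι K : Type*} [Fintype σ] [Fintype ι] [Field K]
    {k : ℕ} {l : MvPolynomial σ K} (hl : l.IsHomogeneous 1) (hl0 : l ≠ 0)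
    {g : ι → MvPolynomial σ K} (hg : ∀ i, (g i).IsHomogeneous k)
    (h : ∀ p : MvPolynomial σ K, p.IsHomogeneous k → l * p ∈ Ideal.span (Set.range g)) :
    (Fintype.card σ).multichoose k ≤ Fintype.card σ * Fintype.card ι := by
  classical
  let e : Sym σ k → σ →₀ ℕ := fun s => Multiset.toFinsupp (s : Multiset σ)
  have he : Function.Injective e := fun s t hst =>
    Sym.coe_injective (Multiset.toFinsupp.injective hst)
  let v : Sym σ k → MvPolynomial σ K := fun s => l * monomial (e s) 1
  have hv : LinearIndependent K v := by
    have h1 : LinearIndependent K fun s : Sym σ k => monomial (R := K) (e s) 1 := by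
      have := (basisMonomials σ K).linearIndependent.comp e he
      simpa [Function.comp_def] using this
    exact h1.map' (LinearMap.mulLeft K l)
      (LinearMap.ker_eq_bot.2 fun p q hpq => mul_left_cancel₀ hl0 hpq)
  let w : σ × ι → MvPolynomial σ K := fun t => X t.1 * g t.2
  have hvw : Set.range v ≤ Submodule.span K (Set.range w) := by
    rintro _ ⟨s, rfl⟩
    have hs : (monomial (e s) (1 : K)).IsHomogeneous k := by
      apply isHomogeneous_monomial
      simp [e, Finsupp.degree_eq_sum]
    obtain ⟨c, hc⟩ := Ideal.mem_span_range_iff_exists_fun.1 (h _ hs)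
    have hd : v s = ∑ i, homogeneousComponent 1 (c i) * g i := by
      have h2 : (v s).IsHomogeneous (1 + k) := hl.mul hs
      rw [← homogeneousComponent_eq_self h2]
      simp only [v, ← hc, map_sum, homogeneousComponent_mul_of_right (hg _)]
    rw [SetLike.mem_coe, hd]
    refine Submodule.sum_mem _ fun i _ => ?_
    obtain ⟨a, ha⟩ := isHomogeneous_one_iff_exists_sum.1
      (homogeneousComponent_isHomogeneous 1 (c i))
    rw [← ha, Finset.sum_mul]
    refine Submodule.sum_mem _ fun j _ => ?_
    rw [smul_mul_assoc]
    exact Submodule.smul_mem _ _ (Submodule.subset_span ⟨(j, i), rfl⟩)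
  calc (Fintype.card σ).multichoose k = Fintype.card (Sym σ k) :=
        (Sym.card_sym_eq_multichoose σ k).symm
    _ ≤ Fintype.card (Set.range w) := linearIndependent_le_span_aux' v hv _ hvw
    _ ≤ Fintype.card (σ × ι) := Fintype.card_range_le w
    _ = _ := Fintype.card_prod σ ι

lemma mul_succ_lt_multichoose {n k : ℕ} (hn : 5 ≤ n) (hk : 3 ≤ k) :
    n * (n + 1) < n.multichoose k := by
  obtain ⟨m, rfl⟩ := Nat.exists_eq_add_of_le hn
  obtain ⟨j, rfl⟩ := Nat.exists_eq_add_of_le hk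
  have h1 : (5 + m).multichoose 3 ≤ (5 + m).multichoose (3 + j) := by
    rw [Nat.multichoose_eq, Nat.multichoose_eq,
      Nat.choose_symm_of_eq_add (show 5 + m + 3 - 1 = 3 + (4 + m) by lia),
      Nat.choose_symm_of_eq_add (show 5 + m + (3 + j) - 1 = (3 + j) + (4 + m) by lia)]
    exact Nat.choose_le_choose _ (by lia)
  refine lt_of_lt_of_le ?_ h1
  rw [Nat.multichoose_eq, show 5 + m + 3 - 1 = m + 6 + 1 by lia]
  have h2 := Nat.descFactorial_eq_factorial_mul_choose (m + 6 + 1) 3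
  simp only [Nat.descFactorial_succ, Nat.descFactorial_zero, Nat.factorial] at h2
  have e1 : m + 6 + 1 - 2 = m + 5 := by lia
  have e2 : m + 6 + 1 - 1 = m + 6 := by lia
  rw [e1, e2, Nat.sub_zero] at h2
  nlinarith

/-- For a nonzero linear form `y`, restriction to the hyperplane `y = 0`, expressed in
coordinates on that hyperplane. -/
lemma exists_restriction_to_hyperplane {n : ℕ} {K : Type*} [Field K]
    {y : MvPolynomial (Fin (n + 1)) K} (hy : y.IsHomogeneous 1) (hy0 : y ≠ 0) :
    ∃ π : MvPolynomial (Fin (n + 1)) K →ₐ[K] MvPolynomial (Fin n) K,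
      π y = 0 ∧
      (∀ x : MvPolynomial (Fin (n + 1)) K, x.IsHomogeneous 1 → π x = 0 → ∃ c : K, x = c • y) ∧
      (∀ k (p : MvPolynomial (Fin (n + 1)) K), p.IsHomogeneous k → (π p).IsHomogeneous k) ∧
      ∀ k (p : MvPolynomial (Fin n) K), p.IsHomogeneous k →
        ∃ q : MvPolynomial (Fin (n + 1)) K, q.IsHomogeneous k ∧ π q = p := by
  obtain ⟨a, rfl⟩ := isHomogeneous_one_iff_exists_sum.1 hy
  obtain ⟨k, hk⟩ : ∃ k, a k ≠ 0 := by
    by_contra! h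
    exact hy0 (by simp [h])
  let v : MvPolynomial (Fin n) K := ∑ j, (-(a k)⁻¹ * a (k.succAbove j)) • X j
  let π : MvPolynomial (Fin (n + 1)) K →ₐ[K] MvPolynomial (Fin n) K :=
    aeval (k.insertNth (α := fun _ => MvPolynomial (Fin n) K) v X)
  have hπ : ∀ b : Fin (n + 1) → K, π (∑ i, b i • X i) =
      ∑ j, (b (k.succAbove j) - b k * (a k)⁻¹ * a (k.succAbove j)) • X j := by
    intro b
    simp only [Fin.sum_univ_succAbove _ k, map_add, map_sum, map_smul, π, aeval_X,
      Fin.insertNth_apply_same, Fin.insertNth_apply_succAbove, v, Finset.smul_sum,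
      ← Finset.sum_add_distrib, smul_smul, ← add_smul]
    refine Finset.sum_congr rfl fun j _ => ?_
    congr 1
    ring
  refine ⟨π, ?_, ?_, ?_, ?_⟩
  · rw [hπ]
    simp [hk]
  · intro x hx hx0
    obtain ⟨b, rfl⟩ := isHomogeneous_one_iff_exists_sum.1 hx
    rw [hπ] at hx0
    have hb := Fintype.linearIndependent_iff.1 (linearIndependent_X (Fin n) K) _ hx0
    refine ⟨b k * (a k)⁻¹, ?_⟩
    rw [Finset.smul_sum]
    refine Finset.sum_congr rfl fun i _ => ?_
    rw [smul_smul]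
    congr 1
    obtain rfl | ⟨j, rfl⟩ := k.eq_self_or_eq_succAbove i
    · field_simp
    · exact sub_eq_zero.1 (hb j)
  · intro m p hp
    have := hp.aeval (k.insertNth (α := fun _ => MvPolynomial (Fin n) K) v X) (n := 1) fun i => by
      obtain rfl | ⟨j, rfl⟩ := k.eq_self_or_eq_succAbove i
      · rw [Fin.insertNth_apply_same]
        exact isHomogeneous_one_iff_exists_sum.2 ⟨_, rfl⟩
      · rw [Fin.insertNth_apply_succAbove]
        exact isHomogeneous_X K j
    rwa [one_mul] at this
  · intro m p hp
    refine ⟨rename k.succAbove p, hp.rename_isHomogeneous, ?_⟩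
    simp only [π, aeval_rename]
    convert aeval_X_left_apply p using 2
    ext j
    simp

/-- The conclusion holds for every form of degree `d`, not only for generic ones. -/
lemma eq_smul_of_forall_exists_mk_mul_eq {n d : ℕ} (hd : 4 ≤ d) (hn : 5 ≤ n) {f x y : S n}
    (hf : f.IsHomogeneous d) (hx : x.IsHomogeneous 1) (hy : y.IsHomogeneous 1) (hy0 : y ≠ 0)
    (h : ∀ p : S n, p.IsHomogeneous (d - 1) → ∃ q : S n,
      Ideal.Quotient.mk (jacobianIdeal f) (x * p) = Ideal.Quotient.mk (jacobianIdeal f) (y * q)) :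
    ∃ c : ℂ, x = c • y := by
  obtain ⟨π, hπy, hker, hhom, hsurj⟩ := exists_restriction_to_hyperplane hy hy0
  apply hker x hx
  by_contra hx0
  have hle := multichoose_le_of_mul_mem_span (hhom 1 x hx) hx0
    (g := fun i => π (pderiv i f)) (fun i => hhom _ _ hf.pderiv) fun p hp => by
      obtain ⟨p, hp', rfl⟩ := hsurj _ p hp
      obtain ⟨q, hq⟩ := h p hp'
      have hmem := Ideal.mem_map_of_mem π (Ideal.Quotient.eq.1 hq)
      rw [jacobianIdeal, Ideal.map_span, ← Set.range_comp] at hmem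
      simpa [hπy, Function.comp_def] using hmem
  rw [Fintype.card_fin, Fintype.card_fin] at hle
  exact absurd (mul_succ_lt_multichoose hn (by lia)) hle.not_gt

/-- For `d ≥ 4`, `n ≥ 5` and generic `f ∈ S^d`: if `x, y` are nonzero linear forms with
`x·R_f^{d-1} = y·R_f^{d-1}` as subspaces of `R_f^d`, then `x` and `y` are proportional.
(Hence `x ↦ x·R_f^{d-1}` is injective on `ℙ(S¹)`.) -/
theorem multiplication_ideal_determines_linear_form (n d : ℕ) (hd : 4 ≤ d) (hn : 5 ≤ n) :
    GenericallyHolds (fun f : MvPolynomial.homogeneousSubmodule (Fin (n + 1)) ℂ d =>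
      ∀ x y : S n, x.IsHomogeneous 1 → y.IsHomogeneous 1 → x ≠ 0 → y ≠ 0 →
        {z : S n ⧸ jacobianIdeal (f : S n) | ∃ p : S n, p.IsHomogeneous (d - 1) ∧
            z = Ideal.Quotient.mk (jacobianIdeal (f : S n)) (x * p)} =
          {z : S n ⧸ jacobianIdeal (f : S n) | ∃ p : S n, p.IsHomogeneous (d - 1) ∧
            z = Ideal.Quotient.mk (jacobianIdeal (f : S n)) (y * p)} →
        ∃ c : ℂ, x = c • y) := by
  refine ⟨1, Subalgebra.one_mem _, ⟨0, one_ne_zero⟩, fun f _ x y hx hy _ hy0 h => ?_⟩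
  refine eq_smul_of_forall_exists_mk_mul_eq hd hn ((mem_homogeneousSubmodule d _).1 f.2)
    hx hy hy0 fun p hp => ?_
  obtain ⟨q, -, hq⟩ := h.subset ⟨p, hp, rfl⟩
  exact ⟨q, hq⟩

end
end
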